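/- arXiv:math/0505653 — 2 statements merged into one kernel-verified Lean document; each statement's English description precedes it below -/
import Mathlib

section
/- Let G be a finite group and ψ a 2-cocycle on G with values in ℂˣ. Then the number of isomorphism classes of finite-dimensional irreducible modules over the twisted group algebra ℂ_ψG is equal to the number of conjugacy classes of G consisting of ψ-regular elements. -/
/-- A 2-cocycle on `G` with values in `ℂˣ` (trivial action). -/
def IsTwoCocycle {G : Type*} [Group G] (ψ : G → G → ℂˣ) : Prop :=
  ∀ g h k : G, ψ g h * ψ (g * h) k = ψ h k * ψ g (h * k)

/-- An element `g` is `ψ`-regular if `ψ(g,h) = ψ(h,g)` for every `h` in the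
centralizer of `g`. -/
def IsPsiRegular {G : Type*} [Group G] (ψ : G → G → ℂˣ) (g : G) : Prop :=
  ∀ h ∈ Subgroup.centralizer {g}, ψ g h = ψ h g

/-- A finite-dimensional module over the twisted group algebra `ℂ_ψ G`,
packaged as a projective representation: a finite-dimensional complex vector
space `V` together with operators `ρ g` satisfying
`ρ g * ρ h = ψ(g,h) • ρ(g h)` and (unitality of the module) `ρ 1 = ψ(1,1) • 1`. -/
structure TwistedGroupAlgebraModule (G : Type*) [Group G] (ψ : G → G → ℂˣ) where
  V : Type
  [isAddCommGroup : AddCommGroup V]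
  [isModule : Module ℂ V]
  [isFinDim : FiniteDimensional ℂ V]
  ρ : G → Module.End ℂ V
  mul_eq : ∀ g h : G, ρ g * ρ h = (ψ g h : ℂ) • ρ (g * h)
  one_eq : ρ 1 = (ψ 1 1 : ℂ) • 1

attribute [instance] TwistedGroupAlgebraModule.isAddCommGroup
  TwistedGroupAlgebraModule.isModule TwistedGroupAlgebraModule.isFinDim

/-- A `ℂ_ψ G`-module is irreducible if it is nonzero and has no nontrivial
invariant subspaces. -/
def TwistedGroupAlgebraModule.Irreducible {G : Type*} [Group G]
    {ψ : G → G → ℂˣ} (τ : TwistedGroupAlgebraModule G ψ) : Prop :=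
  Nontrivial τ.V ∧
    ∀ p : Submodule ℂ τ.V, (∀ g : G, p.map (τ.ρ g) ≤ p) → p = ⊥ ∨ p = ⊤

/-- Isomorphism of `ℂ_ψ G`-modules: a `ℂ`-linear equivalence commuting with
the action of every `g ∈ G`. -/
def TwistedGroupAlgebraModule.Iso {G : Type*} [Group G] {ψ : G → G → ℂˣ}
    (τ σ : TwistedGroupAlgebraModule G ψ) : Prop :=
  ∃ e : τ.V ≃ₗ[ℂ] σ.V, ∀ g : G, (e : τ.V →ₗ[ℂ] σ.V) ∘ₗ τ.ρ g = σ.ρ g ∘ₗ (e : τ.V →ₗ[ℂ] σ.V)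

/-- A family of vectors with a diagonal, jointly injective family of functionals has as many
members as the dimension of the space. -/
theorem Module.nat_card_eq_finrank_of_diagonal {K M ι : Type*} [Field K] [AddCommGroup M]
    [Module K M] [FiniteDimensional K M] (v : ι → M) (φ : ι → M →ₗ[K] K)
    (hne : ∀ i, φ i (v i) ≠ 0) (hz : ∀ i j, i ≠ j → φ i (v j) = 0)
    (hinj : ∀ m, (∀ i, φ i m = 0) → m = 0) : Nat.card ι = Module.finrank K M := by
  have hv : LinearIndependent K v := by
    rw [linearIndependent_iff']
    intro s c hc i hi
    have h := congrArg (φ i) hc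
    rw [map_sum, map_zero, Finset.sum_eq_single i] at h
    · simpa [hne i] using h
    · intro j _ hj
      simp [hz i j hj.symm]
    · exact fun h' => absurd hi h'
  have := hv.finite
  have := Fintype.ofFinite ι
  apply le_antisymm
  · rw [Nat.card_eq_fintype_card]
    exact hv.fintype_card_le_finrank
  · have h := LinearMap.finrank_le_finrank_of_injective (f := LinearMap.pi φ) <| by
      rw [injective_iff_map_eq_zero]
      exact fun m hm => hinj m fun i => congrFun hm i
    simpa [Nat.card_eq_fintype_card] using h

/-- The operator `X ↦ A ∘ X ∘ B` on linear maps has trace `tr A * tr B`. -/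
theorem LinearMap.trace_lcomp_comp {K V W : Type*} [Field K] [AddCommGroup V] [Module K V]
    [FiniteDimensional K V] [AddCommGroup W] [Module K W] [FiniteDimensional K W]
    (A : Module.End K W) (B : Module.End K V) (L : Module.End K (V →ₗ[K] W))
    (hL : ∀ X, L X = A ∘ₗ X ∘ₗ B) :
    LinearMap.trace K _ L = LinearMap.trace K W A * LinearMap.trace K V B := by
  let e := dualTensorHomEquiv K V W
  let T := TensorProduct.map (Module.Dual.transpose (R := K) B) A
  have h : L ∘ₗ e.toLinearMap = e.toLinearMap ∘ₗ T := by
    refine TensorProduct.ext' fun f w => ?_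
    ext v
    simp [e, T, hL, Module.Dual.transpose_apply]
  have hT : L = e.conj T := by
    rw [LinearEquiv.conj_apply, ← h, LinearMap.comp_assoc, LinearEquiv.comp_symm,
      LinearMap.comp_id]
  have hc := LinearMap.trace_conj' (R := K) (M := TensorProduct K (Module.Dual K V) W)
    (N := V →ₗ[K] W) T e
  rw [hT, hc, LinearMap.trace_tensorProduct', LinearMap.trace_transpose', mul_comm]

section Twist

variable {G : Type*} [Group G]

/-- The scalar `c` with `u_h u_g u_h⁻¹ = c • u_{h g h⁻¹}` in the twisted group algebra. -/
def conjFactor (ψ : G → G → ℂˣ) (h g : G) : ℂˣ :=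
  ψ h g / ψ (h * g * h⁻¹) h

variable {ψ : G → G → ℂˣ}

theorem conjFactor_mul (hψ : IsTwoCocycle ψ) (h k g : G) :
    conjFactor ψ (h * k) g = conjFactor ψ h (k * g * k⁻¹) * conjFactor ψ k g := by
  have h₁ := hψ h k g
  have h₂ := hψ (h * (k * g * k⁻¹) * h⁻¹) h k
  have h₃ := hψ h (k * g * k⁻¹) k
  have e : h * k * g * (h * k)⁻¹ = h * (k * g * k⁻¹) * h⁻¹ := by group
  simp only [inv_mul_cancel_right] at h₂ h₃
  unfold conjFactor
  rw [e]
  simp only [Units.ext_iff, Units.val_mul, Units.val_div_eq_div_val] at *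
  rw [div_mul_div_comm, div_eq_div_iff (by simp) (by simp)]
  apply mul_left_cancel₀ (ψ h k).ne_zero
  apply mul_left_cancel₀ (ψ (h * (k * g * k⁻¹)) k).ne_zero
  grind

theorem conjFactor_eq_one_of_mem_centralizer {g h : G} (hg : IsPsiRegular ψ g)
    (hh : h * g * h⁻¹ = g) : conjFactor ψ h g = 1 := by
  rw [conjFactor, hh, hg h, div_self']
  rw [Subgroup.mem_centralizer_singleton_iff]
  exact (mul_inv_eq_iff_eq_mul.1 hh)

variable (ψ) in
/-- Functions on `G` that transform like the trace of a `ℂ_ψ G`-module under conjugation. -/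
def twistedClassFunctions : Submodule ℂ (G → ℂ) where
  carrier := {f | ∀ h g, conjFactor ψ h g * f (h * g * h⁻¹) = f g}
  zero_mem' := by simp
  add_mem' := by
    intro a b ha hb h g
    rw [Pi.add_apply, Pi.add_apply, mul_add, ha h g, hb h g]
  smul_mem' := by
    intro c a ha h g
    rw [Pi.smul_apply, Pi.smul_apply, smul_eq_mul, smul_eq_mul, mul_left_comm, ha h g]

theorem apply_eq_zero_of_isConj {f : G → ℂ} (hf : f ∈ twistedClassFunctions ψ) {g x : G}
    (hgx : IsConj g x) (hx : f x = 0) : f g = 0 := by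
  obtain ⟨h, rfl⟩ := isConj_iff.1 hgx
  rw [← hf h g, hx, mul_zero]

theorem apply_eq_zero_of_not_isPsiRegular {f : G → ℂ} (hf : f ∈ twistedClassFunctions ψ) {g : G}
    (hg : ¬ IsPsiRegular ψ g) : f g = 0 := by
  by_contra hne
  refine hg fun h hh => ?_
  rw [Subgroup.mem_centralizer_singleton_iff] at hh
  have hc : h * g * h⁻¹ = g := mul_inv_eq_iff_eq_mul.2 hh
  have := hf h g
  rw [hc, mul_eq_right₀ hne, Units.val_eq_one, conjFactor, hc, div_eq_one] at this
  exact this.symm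

open Classical in
/-- The twisted class function supported on the conjugacy class of `g`. -/
noncomputable def orbitFunction [Fintype G] (ψ : G → G → ℂˣ) (g : G) (x : G) : ℂ :=
  ∑ h : G, if h * g * h⁻¹ = x then ((conjFactor ψ h g : ℂˣ) : ℂ)⁻¹ else 0

theorem orbitFunction_mem [Fintype G] (hψ : IsTwoCocycle ψ) (g : G) :
    orbitFunction ψ g ∈ twistedClassFunctions ψ := by
  intro k x
  unfold orbitFunction
  rw [← Equiv.sum_comp (Equiv.mulLeft k), Finset.mul_sum]
  refine Finset.sum_congr rfl fun h _ => ?_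
  have e : k * h * g * (k * h)⁻¹ = k * (h * g * h⁻¹) * k⁻¹ := by group
  have e' : k * h * g * (k * h)⁻¹ = k * x * k⁻¹ ↔ h * g * h⁻¹ = x := by
    rw [e, mul_left_inj, mul_right_inj]
  by_cases hx : h * g * h⁻¹ = x
  · rw [Equiv.coe_mulLeft, if_pos (e'.2 hx), if_pos hx, conjFactor_mul hψ, hx, Units.val_mul, mul_inv, mul_inv_cancel_left₀ (Units.ne_zero _)]
  · rw [Equiv.coe_mulLeft, if_neg (e'.not.2 hx), if_neg hx, mul_zero]

theorem orbitFunction_self_ne_zero [Fintype G] {g : G} (hg : IsPsiRegular ψ g) :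
    orbitFunction ψ g g ≠ 0 := by
  classical
  have : orbitFunction ψ g g = ∑ h : G, if h * g * h⁻¹ = g then (1 : ℂ) else 0 := by
    refine Finset.sum_congr rfl fun h _ => ?_
    split_ifs with hh
    · simp [conjFactor_eq_one_of_mem_centralizer hg hh]
    · rfl
  rw [this, Finset.sum_boole, Nat.cast_ne_zero, Finset.card_ne_zero]
  exact ⟨1, by simp⟩

theorem orbitFunction_of_not_isConj [Fintype G] {g x : G} (h : ¬ IsConj g x) :
    orbitFunction ψ g x = 0 :=
  Finset.sum_eq_zero fun k _ => if_neg fun hk => h (isConj_iff.2 ⟨k, hk⟩)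

theorem nat_card_regular_classes_eq_finrank [Finite G] (hψ : IsTwoCocycle ψ) :
    Nat.card {C : ConjClasses G // ∀ g ∈ C.carrier, IsPsiRegular ψ g} =
      Module.finrank ℂ (twistedClassFunctions ψ) := by
  have := Fintype.ofFinite G
  have hout (C : ConjClasses G) : ConjClasses.mk (Quotient.out C) = C := Quotient.out_eq C
  refine Module.nat_card_eq_finrank_of_diagonal
    (fun C => ⟨orbitFunction ψ (Quotient.out C.1), orbitFunction_mem hψ _⟩)
    (fun C => LinearMap.proj (Quotient.out C.1) ∘ₗ (twistedClassFunctions ψ).subtype) ?_ ?_ ?_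
  · intro C
    exact orbitFunction_self_ne_zero (C.2 _ (ConjClasses.mem_carrier_iff_mk_eq.2 (hout _)))
  · intro C D hCD
    refine orbitFunction_of_not_isConj fun h => hCD (Subtype.ext ?_)
    rw [← hout C, ← hout D]
    exact (ConjClasses.mk_eq_mk_iff_isConj.2 h).symm
  · rintro ⟨f, hf⟩ h
    ext g
    by_cases hC : ∀ x ∈ (ConjClasses.mk g).carrier, IsPsiRegular ψ x
    · refine apply_eq_zero_of_isConj hf ?_ (h ⟨_, hC⟩)
      rw [← ConjClasses.mk_eq_mk_iff_isConj, hout]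
    · push Not at hC
      obtain ⟨x, hx, hxr⟩ := hC
      rw [ConjClasses.mem_carrier_iff_mk_eq, ConjClasses.mk_eq_mk_iff_isConj] at hx
      exact apply_eq_zero_of_isConj hf hx.symm (apply_eq_zero_of_not_isPsiRegular hf hxr)

end Twist

namespace TwistedGroupAlgebraModule

variable {G : Type*} [Group G] {ψ : G → G → ℂˣ}

/-- The inverse of the operator `ρ g`. -/
noncomputable def rhoInv (τ : TwistedGroupAlgebraModule G ψ) (g : G) : Module.End ℂ τ.V :=
  ((ψ g g⁻¹ * ψ 1 1 : ℂˣ) : ℂ)⁻¹ • τ.ρ g⁻¹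

variable (τ σ : TwistedGroupAlgebraModule G ψ)

theorem rho_mul_rhoInv (g : G) : τ.ρ g * τ.rhoInv g = 1 := by
  rw [rhoInv, mul_smul_comm, τ.mul_eq, mul_inv_cancel, τ.one_eq, smul_smul, smul_smul,
    mul_assoc, ← Units.val_mul, inv_mul_cancel₀ (Units.ne_zero _), one_smul]

theorem rhoInv_mul_rho (g : G) : τ.rhoInv g * τ.ρ g = 1 :=
  mul_eq_one_comm.1 (τ.rho_mul_rhoInv g)

theorem eq_rhoInv {g : G} {A : Module.End ℂ τ.V} (h : τ.ρ g * A = 1) : A = τ.rhoInv g := by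
  rw [← one_mul A, ← τ.rhoInv_mul_rho g, mul_assoc, h, mul_one]

theorem rhoInv_mul_rhoInv (g h : G) :
    τ.rhoInv h * τ.rhoInv g = (ψ g h : ℂ)⁻¹ • τ.rhoInv (g * h) := by
  have : (ψ g h : ℂ) • (τ.rhoInv h * τ.rhoInv g) = τ.rhoInv (g * h) := by
    apply eq_rhoInv
    rw [mul_smul_comm, ← smul_mul_assoc, ← τ.mul_eq, mul_assoc, ← mul_assoc (τ.ρ h),
      rho_mul_rhoInv, one_mul, rho_mul_rhoInv]
  rw [← this, inv_smul_smul₀ (Units.ne_zero _)]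

theorem rho_conj (h g : G) :
    τ.ρ h * τ.ρ g * τ.rhoInv h = (conjFactor ψ h g : ℂ) • τ.ρ (h * g * h⁻¹) := by
  have key : (conjFactor ψ h g : ℂ) • (τ.ρ (h * g * h⁻¹) * τ.ρ h) = τ.ρ h * τ.ρ g := by
    rw [τ.mul_eq, τ.mul_eq, inv_mul_cancel_right, smul_smul, ← Units.val_mul, conjFactor,
      div_mul_cancel]
  rw [← key, smul_mul_assoc, mul_assoc, rho_mul_rhoInv, mul_one]

theorem rhoInv_conj (h g : G) :
    τ.ρ h * τ.rhoInv g * τ.rhoInv h = (conjFactor ψ h g : ℂ)⁻¹ • τ.rhoInv (h * g * h⁻¹) := by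
  have : (conjFactor ψ h g : ℂ) • (τ.ρ h * τ.rhoInv g * τ.rhoInv h) =
      τ.rhoInv (h * g * h⁻¹) := by
    apply eq_rhoInv
    rw [mul_smul_comm, ← smul_mul_assoc, ← rho_conj]
    calc τ.ρ h * τ.ρ g * τ.rhoInv h * (τ.ρ h * τ.rhoInv g * τ.rhoInv h)
        = τ.ρ h * τ.ρ g * (τ.rhoInv h * τ.ρ h) * τ.rhoInv g * τ.rhoInv h := by
          simp only [mul_assoc]
      _ = τ.ρ h * (τ.ρ g * τ.rhoInv g) * τ.rhoInv h := by
          rw [rhoInv_mul_rho]; simp only [mul_assoc, one_mul]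
      _ = 1 := by rw [rho_mul_rhoInv, mul_one, rho_mul_rhoInv]
  rw [← this, inv_smul_smul₀ (Units.ne_zero _)]

/-- The trace of the action of `G`. -/
noncomputable def character (g : G) : ℂ := LinearMap.trace ℂ τ.V (τ.ρ g)

theorem character_mem : τ.character ∈ twistedClassFunctions ψ := by
  intro h g
  rw [character, character, ← smul_eq_mul, ← map_smul, ← rho_conj, LinearMap.trace_mul_comm,
    ← mul_assoc, rhoInv_mul_rho, one_mul]

/-- The action of `G` on linear maps by conjugation, an ordinary representation. -/
noncomputable def homRep : Representation ℂ G (τ.V →ₗ[ℂ] σ.V) where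
  toFun g :=
    { toFun X := σ.ρ g ∘ₗ X ∘ₗ τ.rhoInv g
      map_add' X Y := by rw [LinearMap.add_comp, LinearMap.comp_add]
      map_smul' c X := by rw [LinearMap.smul_comp, LinearMap.comp_smul, RingHom.id_apply] }
  map_one' := by
    ext X v
    have h : τ.rhoInv 1 = (ψ 1 1 : ℂ)⁻¹ • 1 := by
      refine (τ.eq_rhoInv ?_).symm
      rw [τ.one_eq, smul_mul_smul_comm, mul_inv_cancel₀ (Units.ne_zero _), one_smul, one_mul]
    simp [h, σ.one_eq]
  map_mul' g h := by
    ext X v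
    have h₁ : σ.ρ (g * h) = (ψ g h : ℂ)⁻¹ • (σ.ρ g * σ.ρ h) := by
      rw [σ.mul_eq, inv_smul_smul₀ (Units.ne_zero _)]
    have h₂ : τ.rhoInv (g * h) = (ψ g h : ℂ) • (τ.rhoInv h * τ.rhoInv g) := by
      rw [rhoInv_mul_rhoInv, smul_inv_smul₀ (Units.ne_zero _)]
    simp [h₁, h₂]

theorem homRep_apply (g : G) (X : τ.V →ₗ[ℂ] σ.V) :
    homRep τ σ g X = σ.ρ g ∘ₗ X ∘ₗ τ.rhoInv g := rfl

theorem mem_invariants_homRep {X : τ.V →ₗ[ℂ] σ.V} :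
    X ∈ (homRep τ σ).invariants ↔ ∀ g, X ∘ₗ τ.ρ g = σ.ρ g ∘ₗ X := by
  rw [Representation.mem_invariants]
  refine forall_congr' fun g => ?_
  rw [homRep_apply]
  constructor
  · intro h
    nth_rewrite 1 [← h]
    rw [LinearMap.comp_assoc, LinearMap.comp_assoc, ← Module.End.mul_eq_comp (τ.rhoInv g),
      rhoInv_mul_rho]
    rfl
  · intro h
    rw [← LinearMap.comp_assoc, ← h, LinearMap.comp_assoc, ← Module.End.mul_eq_comp,
      rho_mul_rhoInv]
    rfl

theorem sum_trace_mul_trace [Fintype G] :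
    ∑ g, σ.character g * LinearMap.trace ℂ τ.V (τ.rhoInv g) =
      Fintype.card G * Module.finrank ℂ (homRep τ σ).invariants := by
  have hG : (Fintype.card G : ℂ) ≠ 0 := Nat.cast_ne_zero.2 Fintype.card_ne_zero
  have : Invertible (Fintype.card G : ℂ) := invertibleOfNonzero hG
  rw [← (homRep τ σ).isProj_averageMap.trace]
  simp only [Representation.averageMap, GroupAlgebra.average, map_smul, map_sum, smul_eq_mul,
    Representation.asAlgebraHom_of, mul_invOf_cancel_left']
  refine Finset.sum_congr rfl fun g _ => ?_
  rw [LinearMap.trace_lcomp_comp (σ.ρ g) (τ.rhoInv g) _ (homRep_apply τ σ g), character]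

/-- The restriction of the action to an invariant subspace. -/
noncomputable def sub (p : Submodule ℂ τ.V) (hp : ∀ g, p.map (τ.ρ g) ≤ p) :
    TwistedGroupAlgebraModule G ψ where
  V := p
  ρ g := (τ.ρ g).restrict fun _ hx => hp g (Submodule.mem_map_of_mem hx)
  mul_eq g h := by
    ext x
    exact LinearMap.congr_fun (τ.mul_eq g h) x
  one_eq := by
    ext x
    exact LinearMap.congr_fun τ.one_eq x

theorem Iso.symm {τ σ : TwistedGroupAlgebraModule G ψ} (h : Iso τ σ) : Iso σ τ := by
  obtain ⟨e, he⟩ := h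
  refine ⟨e.symm, fun g => ?_⟩
  ext v
  have := LinearMap.congr_fun (he g) (e.symm v)
  simp at this
  simp [← this]

theorem Iso.trans {τ σ υ : TwistedGroupAlgebraModule G ψ} (h : Iso τ σ) (h' : Iso σ υ) :
    Iso τ υ := by
  obtain ⟨e, he⟩ := h
  obtain ⟨e', he'⟩ := h'
  refine ⟨e.trans e', fun g => ?_⟩
  ext v
  have h₁ := LinearMap.congr_fun (he g) v
  have h₂ := LinearMap.congr_fun (he' g) (e v)
  simp at h₁ h₂
  simp [h₁, h₂]

theorem iso_equivalence : Equivalence (Iso : TwistedGroupAlgebraModule G ψ → _ → Prop) :=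
  ⟨fun _ => ⟨LinearEquiv.refl _ _, fun _ => rfl⟩, Iso.symm, Iso.trans⟩

variable {τ σ}

theorem map_ker_le {X : τ.V →ₗ[ℂ] σ.V} (hX : ∀ g, X ∘ₗ τ.ρ g = σ.ρ g ∘ₗ X) (g : G) :
    (LinearMap.ker X).map (τ.ρ g) ≤ LinearMap.ker X := by
  rw [Submodule.map_le_iff_le_comap]
  intro v hv
  have := LinearMap.congr_fun (hX g) v
  rw [LinearMap.mem_ker] at hv
  simpa [hv] using this

theorem map_range_le {X : τ.V →ₗ[ℂ] σ.V} (hX : ∀ g, X ∘ₗ τ.ρ g = σ.ρ g ∘ₗ X) (g : G) :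
    (LinearMap.range X).map (σ.ρ g) ≤ LinearMap.range X := by
  rw [Submodule.map_le_iff_le_comap]
  rintro _ ⟨v, rfl⟩
  exact ⟨τ.ρ g v, LinearMap.congr_fun (hX g) v⟩

theorem iso_of_intertwining_ne_zero (hτ : τ.Irreducible) (hσ : σ.Irreducible)
    {X : τ.V →ₗ[ℂ] σ.V} (hX : ∀ g, X ∘ₗ τ.ρ g = σ.ρ g ∘ₗ X) (h0 : X ≠ 0) : Iso τ σ := by
  have hk := (hτ.2 _ (map_ker_le hX)).resolve_right fun h => h0 (LinearMap.ker_eq_top.1 h)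
  have hr := (hσ.2 _ (map_range_le hX)).resolve_left fun h => h0 (LinearMap.range_eq_bot.1 h)
  exact ⟨LinearEquiv.ofBijective X ⟨LinearMap.ker_eq_bot.1 hk, LinearMap.range_eq_top.1 hr⟩, hX⟩

theorem finrank_invariants_of_not_iso (hτ : τ.Irreducible) (hσ : σ.Irreducible)
    (h : ¬ Iso τ σ) : Module.finrank ℂ (homRep τ σ).invariants = 0 := by
  rw [Submodule.finrank_eq_zero, Submodule.eq_bot_iff]
  intro X hX
  by_contra h0
  exact h (iso_of_intertwining_ne_zero hτ hσ ((mem_invariants_homRep τ σ).1 hX) h0)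

theorem finrank_invariants_self_ne_zero (hτ : τ.Irreducible) :
    Module.finrank ℂ (homRep τ τ).invariants ≠ 0 := by
  have := hτ.1
  rw [Ne, Submodule.finrank_eq_zero, Submodule.eq_bot_iff]
  intro h
  exact one_ne_zero (h (1 : Module.End ℂ τ.V)
    ((mem_invariants_homRep τ τ).2 fun g => by
      rw [← Module.End.mul_eq_comp, ← Module.End.mul_eq_comp, one_mul, mul_one]))

theorem intertwining_eq_zero_of_trace_eq_zero (hτ : τ.Irreducible) {X : Module.End ℂ τ.V}
    (hX : ∀ g, X ∘ₗ τ.ρ g = τ.ρ g ∘ₗ X) (htr : LinearMap.trace ℂ τ.V X = 0) : X = 0 := by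
  have := hτ.1
  obtain ⟨μ, hμ⟩ := Module.End.exists_eigenvalue X
  have hY (g : G) : (X - μ • (1 : Module.End ℂ τ.V)) ∘ₗ τ.ρ g =
      τ.ρ g ∘ₗ (X - μ • (1 : Module.End ℂ τ.V)) := by
    rw [LinearMap.sub_comp, LinearMap.comp_sub, hX, LinearMap.smul_comp, LinearMap.comp_smul]
    rfl
  have hker : LinearMap.ker (X - μ • (1 : Module.End ℂ τ.V)) = ⊤ := by
    refine (hτ.2 _ (map_ker_le hY)).resolve_left fun h => ?_
    obtain ⟨v, hv, hv0⟩ := hμ.exists_hasEigenvector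
    rw [Module.End.mem_eigenspace_iff] at hv
    refine hv0 ((Submodule.eq_bot_iff _).1 h v ?_)
    simp [hv]
  have hXμ : X = μ • 1 := sub_eq_zero.1 (LinearMap.ker_eq_top.1 hker)
  rw [hXμ, map_smul, LinearMap.trace_one, smul_eq_mul, mul_eq_zero, Nat.cast_eq_zero] at htr
  rw [hXμ, htr.resolve_right Module.finrank_pos.ne', zero_smul]

variable (τ) in
/-- The operator `∑ g, f g • (ρ g)⁻¹`. -/
noncomputable def classOperator [Fintype G] (f : G → ℂ) : Module.End ℂ τ.V :=
  ∑ g, f g • τ.rhoInv g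

theorem classOperator_comm [Fintype G] {f : G → ℂ} (hf : f ∈ twistedClassFunctions ψ) (h : G) :
    τ.classOperator f ∘ₗ τ.ρ h = τ.ρ h ∘ₗ τ.classOperator f := by
  revert h
  rw [← mem_invariants_homRep, Representation.mem_invariants]
  intro h
  rw [homRep_apply, ← Module.End.mul_eq_comp, ← Module.End.mul_eq_comp, ← mul_assoc,
    classOperator, Finset.mul_sum, Finset.sum_mul, ← Equiv.sum_comp (MulAut.conj h).toEquiv fun g => f g • τ.rhoInv g]
  refine Finset.sum_congr rfl fun g _ => ?_
  rw [mul_smul_comm, smul_mul_assoc, rhoInv_conj, smul_smul, ← hf h g, mul_comm, ← mul_assoc,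
    inv_mul_cancel₀ (Units.ne_zero _), one_mul]
  rfl

theorem classOperator_conj [Fintype G] (f : G → ℂ) (e : τ.V ≃ₗ[ℂ] σ.V)
    (he : ∀ g, (e : τ.V →ₗ[ℂ] σ.V) ∘ₗ τ.ρ g = σ.ρ g ∘ₗ (e : τ.V →ₗ[ℂ] σ.V)) :
    e.conj (τ.classOperator f) = σ.classOperator f := by
  have h (g : G) : e.conj (τ.ρ g) = σ.ρ g := by
    rw [LinearEquiv.conj_apply, he, LinearMap.comp_assoc, LinearEquiv.comp_symm,
      LinearMap.comp_id]
  simp only [classOperator, rhoInv, map_sum, map_smul, h]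

theorem coe_classOperator_sub [Fintype G] (f : G → ℂ) (p : Submodule ℂ τ.V)
    (hp : ∀ g, p.map (τ.ρ g) ≤ p) (v : p) :
    p.subtype ((τ.sub p hp).classOperator f v) = τ.classOperator f v := by
  let ι : (τ.sub p hp).V →ₗ[ℂ] τ.V := p.subtype
  have h (w : (τ.sub p hp).V) :
      ι ((τ.sub p hp).classOperator f w) = τ.classOperator f (ι w) := by
    rw [classOperator, classOperator, LinearMap.sum_apply, LinearMap.sum_apply, map_sum]
    rfl
  exact h v

/-- Maschke: an invariant subspace is the range of an intertwining projection. -/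
theorem exists_intertwining_projection [Finite G] (p : Submodule ℂ τ.V)
    (hp : ∀ g, p.map (τ.ρ g) ≤ p) :
    ∃ P : Module.End ℂ τ.V, (∀ g, P ∘ₗ τ.ρ g = τ.ρ g ∘ₗ P) ∧ LinearMap.IsProj p P := by
  have := Fintype.ofFinite G
  have hG : (Fintype.card G : ℂ) ≠ 0 := Nat.cast_ne_zero.2 Fintype.card_ne_zero
  have : Invertible (Fintype.card G : ℂ) := invertibleOfNonzero hG
  obtain ⟨q, hq⟩ := p.subtype.exists_leftInverse_of_injective p.ker_subtype
  have hmem (g : G) {v : τ.V} (hv : v ∈ p) : τ.ρ g v ∈ p := hp g (Submodule.mem_map_of_mem hv)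
  have hmem' (g : G) {v : τ.V} (hv : v ∈ p) : τ.rhoInv g v ∈ p := p.smul_mem _ (hmem _ hv)
  have hP : LinearMap.IsProj p (p.subtype ∘ₗ q) :=
    ⟨fun v => (q v).2, fun v hv => congrArg Subtype.val (LinearMap.congr_fun hq ⟨v, hv⟩)⟩
  have hg (g : G) : LinearMap.IsProj p (homRep τ τ g (p.subtype ∘ₗ q)) := by
    refine ⟨fun v => hmem g (hP.map_mem _), fun v hv => ?_⟩
    rw [homRep_apply, LinearMap.comp_apply, LinearMap.comp_apply, hP.map_id _ (hmem' g hv)]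
    exact LinearMap.congr_fun (τ.rho_mul_rhoInv g) v
  refine ⟨(homRep τ τ).averageMap (p.subtype ∘ₗ q),
    (mem_invariants_homRep τ τ).1 ((homRep τ τ).averageMap_invariant _), ?_⟩
  have he : (homRep τ τ).averageMap (p.subtype ∘ₗ q) =
      ⅟(Fintype.card G : ℂ) • ∑ g, homRep τ τ g (p.subtype ∘ₗ q) := by
    simp only [Representation.averageMap, GroupAlgebra.average, map_smul, map_sum,
      Representation.asAlgebraHom_of, LinearMap.smul_apply, LinearMap.sum_apply]
  rw [he]
  refine ⟨fun v => ?_, fun v hv => ?_⟩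
  · rw [LinearMap.smul_apply, LinearMap.sum_apply]
    exact p.smul_mem _ (p.sum_mem fun g _ => (hg g).map_mem v)
  · rw [LinearMap.smul_apply, LinearMap.sum_apply,
      Finset.sum_congr rfl fun g _ => (hg g).map_id v hv]
    simp [← Nat.cast_smul_eq_nsmul ℂ, smul_smul]

/-- A class operator that kills every irreducible module kills every module. -/
theorem classOperator_eq_zero [Fintype G] {f : G → ℂ}
    (h : ∀ τ : TwistedGroupAlgebraModule G ψ, τ.Irreducible → τ.classOperator f = 0)
    (τ : TwistedGroupAlgebraModule G ψ) : τ.classOperator f = 0 := by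
  induction hn : Module.finrank ℂ τ.V using Nat.strong_induction_on generalizing τ with
  | _ n ih =>
  by_cases hirr : τ.Irreducible
  · exact h τ hirr
  rcases subsingleton_or_nontrivial τ.V with hs | hs
  · exact Subsingleton.elim _ _
  have vanish (p : Submodule ℂ τ.V) (hp : ∀ g, p.map (τ.ρ g) ≤ p) (htop : p ≠ ⊤) {v : τ.V}
      (hv : v ∈ p) : τ.classOperator f v = 0 := by
    rw [← τ.coe_classOperator_sub f p hp ⟨v, hv⟩,
      ih _ (hn ▸ Submodule.finrank_lt htop) (τ.sub p hp) rfl]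
    exact map_zero p.subtype
  rw [Irreducible, not_and] at hirr
  have hred := hirr hs
  push Not at hred
  obtain ⟨p, hp, hbot, htop⟩ := hred
  obtain ⟨P, hcomm, hP⟩ := τ.exists_intertwining_projection p hp
  have hker : LinearMap.ker P ≠ ⊤ := fun hk => hbot <| by
    rw [Submodule.eq_bot_iff]
    intro v hv
    rw [← hP.map_id v hv, LinearMap.ker_eq_top.1 hk, LinearMap.zero_apply]
  ext v
  have h₁ := vanish p hp htop (hP.map_mem v)
  have h₂ : τ.classOperator f (v - P v) = 0 := by
    refine vanish _ (map_ker_le hcomm) hker ?_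
    rw [LinearMap.mem_ker, map_sub, hP.map_id _ (hP.map_mem v), sub_self]
  rw [map_sub, h₁, sub_zero] at h₂
  exact h₂

/-- Left multiplication by `u_g` on `ℂ_ψ G`, in coordinates. -/
def leftMul (ψ : G → G → ℂˣ) (g : G) : Module.End ℂ (G → ℂ) where
  toFun φ x := ψ g (g⁻¹ * x) * φ (g⁻¹ * x)
  map_add' φ φ' := by
    ext x
    simp [mul_add]
  map_smul' c φ := by
    ext x
    simp [mul_left_comm]

theorem leftMul_mul (hψ : IsTwoCocycle ψ) (g h : G) :
    leftMul ψ g * leftMul ψ h = (ψ g h : ℂ) • leftMul ψ (g * h) := by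
  refine LinearMap.ext fun φ => funext fun x => ?_
  have := congrArg Units.val (hψ g h (h⁻¹ * (g⁻¹ * x)))
  simp only [Units.val_mul, mul_inv_cancel_left] at this
  simp only [leftMul, Module.End.mul_apply, LinearMap.coe_mk, AddHom.coe_mk,
    LinearMap.smul_apply, Pi.smul_apply, smul_eq_mul, mul_inv_rev]
  rw [mul_assoc h⁻¹, ← mul_assoc, ← mul_assoc (ψ g h : ℂ), this, mul_comm (ψ g _ : ℂ)]

theorem leftMul_one (hψ : IsTwoCocycle ψ) : leftMul ψ 1 = (ψ 1 1 : ℂ) • 1 := by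
  refine LinearMap.ext fun φ => funext fun x => ?_
  have := hψ 1 1 x
  simp only [mul_one, one_mul, mul_left_inj] at this
  simp [leftMul, this]

/-- The regular module, on coordinate vectors indexed by `Fin (Nat.card G)`. -/
noncomputable def regular [Finite G] (hψ : IsTwoCocycle ψ) : TwistedGroupAlgebraModule G ψ where
  V := Fin (Nat.card G) → ℂ
  ρ g := (LinearEquiv.funCongrLeft ℂ ℂ (Finite.equivFin G).symm).conj (leftMul ψ g)
  mul_eq g h := by
    rw [← map_smul, ← leftMul_mul hψ, Module.End.mul_eq_comp, Module.End.mul_eq_comp,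
      LinearEquiv.conj_comp]
  one_eq := by
    rw [leftMul_one hψ, map_smul, Module.End.one_eq_id, LinearEquiv.conj_id]
    rfl

theorem eq_zero_of_classOperator_regular [Fintype G] (hψ : IsTwoCocycle ψ) {f : G → ℂ}
    (h : (regular hψ).classOperator f = 0) : f = 0 := by
  classical
  let e := LinearEquiv.funCongrLeft ℂ ℂ (Finite.equivFin G).symm
  have hinv (g : G) : (regular hψ).rhoInv g =
      e.conj (((ψ g g⁻¹ * ψ 1 1 : ℂˣ) : ℂ)⁻¹ • leftMul ψ g⁻¹) := (map_smul e.conj _ _).symm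
  have h' : ∑ g, f g • ((ψ g g⁻¹ * ψ 1 1 : ℂˣ) : ℂ)⁻¹ • leftMul ψ g⁻¹ = 0 := by
    apply e.conj.injective
    rw [map_zero, map_sum]
    refine Eq.trans (Finset.sum_congr rfl fun g _ => ?_) h
    rw [map_smul, hinv]
    rfl
  funext g
  have hg := congrFun (LinearMap.congr_fun h' (Pi.single 1 1)) g⁻¹
  rw [LinearMap.sum_apply, Finset.sum_apply, Finset.sum_eq_single g] at hg
  · simpa [leftMul] using hg
  · intro x _ hx
    have : x * g⁻¹ ≠ 1 := fun h => hx (mul_inv_eq_one.1 h)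
    simp [leftMul, this]
  · simp

theorem nat_card_irreducibles_eq_finrank [Finite G] (hψ : IsTwoCocycle ψ) :
    Nat.card
      (Quot fun (τ σ : {τ : TwistedGroupAlgebraModule G ψ // τ.Irreducible}) =>
        TwistedGroupAlgebraModule.Iso τ.1 σ.1) =
    Module.finrank ℂ (twistedClassFunctions ψ) := by
  have := Fintype.ofFinite G
  let φ (τ : TwistedGroupAlgebraModule G ψ) : twistedClassFunctions ψ →ₗ[ℂ] ℂ :=
    { toFun f := ∑ g, f.1 g * LinearMap.trace ℂ τ.V (τ.rhoInv g)
      map_add' f f' := by simp [add_mul, Finset.sum_add_distrib]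
      map_smul' c f := by simp [mul_assoc, Finset.mul_sum] }
  have hφ (τ) (f : twistedClassFunctions ψ) :
      φ τ f = LinearMap.trace ℂ τ.V (τ.classOperator f.1) := by
    simp [φ, classOperator]
  have hG : (Fintype.card G : ℂ) ≠ 0 := Nat.cast_ne_zero.2 Fintype.card_ne_zero
  refine Module.nat_card_eq_finrank_of_diagonal
    (fun i => ⟨_, i.out.1.character_mem⟩) (fun i => φ i.out.1) ?_ ?_ ?_
  · intro i
    change ∑ g, _ ≠ 0
    rw [sum_trace_mul_trace]
    exact mul_ne_zero hG (Nat.cast_ne_zero.2 (finrank_invariants_self_ne_zero i.out.2))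
  · intro i j hij
    change ∑ g, _ = _
    rw [sum_trace_mul_trace, finrank_invariants_of_not_iso i.out.2 j.out.2, Nat.cast_zero, mul_zero]
    intro h
    apply hij
    rw [← i.out_eq, ← j.out_eq]
    exact Quot.sound h
  · intro f hf
    refine Subtype.ext (eq_zero_of_classOperator_regular hψ (classOperator_eq_zero ?_ _))
    intro τ hτ
    let r := fun τ σ : {τ : TwistedGroupAlgebraModule G ψ // τ.Irreducible} => Iso τ.1 σ.1
    have hr : Equivalence r := iso_equivalence.comap Subtype.val
    obtain ⟨e, he⟩ : Iso (Quot.mk r ⟨τ, hτ⟩).out.1 τ :=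
      hr.eqvGen_iff.1 (Quot.eqvGen_exact (Quot.out_eq (Quot.mk r ⟨τ, hτ⟩)))
    refine intertwining_eq_zero_of_trace_eq_zero hτ (classOperator_comm f.2) ?_
    rw [← hf (Quot.mk r ⟨τ, hτ⟩), hφ, ← classOperator_conj f.1 e he, LinearMap.trace_conj']

end TwistedGroupAlgebraModule

/-- The number of isomorphism classes of finite-dimensional irreducible
`ℂ_ψ G`-modules equals the number of `ψ`-regular conjugacy classes of `G`. -/
theorem card_irreducibles_eq_card_regular_classes {G : Type*} [Group G]
    [Finite G] (ψ : G → G → ℂˣ) (hψ : IsTwoCocycle ψ) :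
    Nat.card
      (Quot fun (τ σ : {τ : TwistedGroupAlgebraModule G ψ // τ.Irreducible}) =>
        TwistedGroupAlgebraModule.Iso τ.1 σ.1) =
    Nat.card {C : ConjClasses G // ∀ g ∈ C.carrier, IsPsiRegular ψ g} := by
  rw [TwistedGroupAlgebraModule.nat_card_irreducibles_eq_finrank hψ,
    nat_card_regular_classes_eq_finrank hψ]
end

section
/- Let (W, S) be a Coxeter system with W finite and S finite, whose Coxeter graph is connected (i.e., one cannot partition S into two nonempty subsets S₁, S₂ such that every element of S₁ commutes with every element of S₂), and which is not of type Bₙ, i.e., the Coxeter matrix of (W,S) is not isomorphic (after relabeling) to the matrix with m(i,i+1) = 3 for 1 ≤ i ≤ n−2, m(n−1,n) = 4, and m(i,j) = 2 for |i−j| ≥ 2. Let ψ be a 2-cocycle on W with values in ℂˣ. If some reflection of W (i.e., some W-conjugate of an element of S) is ψ-regular, then ψ is a coboundary. -/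
/-- A 2-cocycle is a coboundary if it is cohomologous to the trivial cocycle. -/
def IsCoboundary {G : Type*} [Group G] (ψ : G → G → ℂˣ) : Prop :=
  ∃ μ : G → ℂˣ, ∀ g h : G, ψ g h = μ g * μ h * (μ (g * h))⁻¹

namespace CoxeterMatrix

variable {B : Type*} (M : CoxeterMatrix B)

/-- The entries of the Tits form: `-cos (π / m)`, which is `-1` when `m = 0` encodes `∞`. -/
noncomputable def titsEntry (i j : B) : ℝ := -Real.cos (Real.pi / M i j)

theorem titsEntry_symm (i j : B) : M.titsEntry i j = M.titsEntry j i := by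
  rw [titsEntry, titsEntry, M.symmetric]

@[simp] theorem titsEntry_self (i : B) : M.titsEntry i i = 1 := by
  simp [titsEntry]

theorem titsEntry_of_eq_two {i j : B} (h : M i j = 2) : M.titsEntry i j = 0 := by
  simp [titsEntry, h]

theorem titsEntry_of_eq_zero {i j : B} (h : M i j = 0) : M.titsEntry i j = -1 := by
  simp [titsEntry, h]

theorem titsEntry_le_of_le {i j : B} {n : ℕ} (hn : 1 ≤ n) (h : n ≤ M i j) :
    M.titsEntry i j ≤ -Real.cos (Real.pi / n) := by
  have hn' : (1 : ℝ) ≤ n := by exact_mod_cast hn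
  have h' : (n : ℝ) ≤ M i j := by exact_mod_cast h
  refine neg_le_neg (Real.cos_le_cos_of_nonneg_of_le_pi (by positivity) ?_ ?_)
  · exact div_le_self Real.pi_pos.le hn'
  · gcongr

theorem titsEntry_nonpos {i j : B} (h : i ≠ j) : M.titsEntry i j ≤ 0 := by
  have h1 := M.off_diagonal i j h
  rcases Nat.eq_zero_or_pos (M i j) with h0 | h0
  · rw [M.titsEntry_of_eq_zero h0]; norm_num
  · have := M.titsEntry_le_of_le (n := 2) (by norm_num) (i := i) (j := j) (by lia)
    simpa using this

theorem titsEntry_le_neg_half {i j : B} (h : i ≠ j) (h2 : M i j ≠ 2) :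
    M.titsEntry i j ≤ -(1 / 2) := by
  have h1 := M.off_diagonal i j h
  rcases Nat.eq_zero_or_pos (M i j) with h0 | h0
  · rw [M.titsEntry_of_eq_zero h0]; norm_num
  · have := M.titsEntry_le_of_le (n := 3) (by norm_num) (i := i) (j := j) (by lia)
    simpa using this

variable [Fintype B] [DecidableEq B]

/-- The Tits form of a Coxeter matrix. -/
noncomputable def titsForm : LinearMap.BilinForm ℝ (B → ℝ) :=
  Matrix.toBilin' (Matrix.of M.titsEntry)

theorem titsForm_single (i j : B) :
    M.titsForm (Pi.single i 1) (Pi.single j 1) = M.titsEntry i j := by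
  simp [titsForm]

theorem titsForm_comm (v w : B → ℝ) : M.titsForm v w = M.titsForm w v := by
  simp only [titsForm, Matrix.toBilin'_apply, Matrix.of_apply]
  rw [Finset.sum_comm]
  refine Finset.sum_congr rfl fun i _ => Finset.sum_congr rfl fun j _ => ?_
  rw [M.titsEntry_symm]; ring

/-- The coroot attached to a simple root in the geometric representation. -/
noncomputable def simpleCoroot (i : B) : Module.Dual ℝ (B → ℝ) :=
  (2 : ℝ) • M.titsForm (Pi.single i 1)

theorem simpleCoroot_single (i j : B) :
    M.simpleCoroot i (Pi.single j 1) = 2 * M.titsEntry i j := by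
  simp [simpleCoroot, titsForm_single]

theorem simpleCoroot_self (i : B) : M.simpleCoroot i (Pi.single i 1) = 2 := by
  simp [simpleCoroot_single]

open Polynomial Polynomial.Chebyshev in
theorem reflection_mul_reflection_pow_eq_one (i j : B) :
    (Module.reflection (M.simpleCoroot_self i) * Module.reflection (M.simpleCoroot_self j))
      ^ M i j = 1 := by
  rcases eq_or_ne i j with rfl | hij
  · rw [M.diagonal, pow_one]
    ext v : 1
    exact Module.involutive_reflection _ _
  have h1 := M.off_diagonal i j hij
  have ht : (M.simpleCoroot i) (Pi.single j 1) * (M.simpleCoroot j) (Pi.single i 1) - 2 =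
      2 * Real.cos (2 * (Real.pi / M i j)) := by
    rw [simpleCoroot_single, simpleCoroot_single, M.titsEntry_symm j i, titsEntry,
      Real.cos_two_mul]
    ring
  ext v : 1
  rw [Module.reflection_mul_reflection_pow_apply _ _ _ _ _ ht.symm]
  rcases Nat.lt_or_ge (M i j) 3 with h3 | h3
  · obtain h0 | h2 : M i j = 0 ∨ M i j = 2 := by lia
    · simp [h0]
    · have hc : M.simpleCoroot i (Pi.single j 1) = 0 := by
        rw [simpleCoroot_single, M.titsEntry_of_eq_two h2, mul_zero]
      have hc' : M.simpleCoroot j (Pi.single i 1) = 0 := by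
        rw [simpleCoroot_single, M.titsEntry_symm, M.titsEntry_of_eq_two h2, mul_zero]
      rw [hc, hc', h2]
      have hcos : Real.cos (2 * (Real.pi / 2)) = -1 := by
        rw [mul_div_cancel₀ _ two_ne_zero, Real.cos_pi]
      norm_num [hcos]
      module
  · have hm : (0 : ℝ) < M i j := by positivity
    have hm3 : (3 : ℝ) ≤ M i j := by exact_mod_cast h3
    set θ := 2 * (Real.pi / M i j) with hθ
    have hs : Real.sin θ ≠ 0 := by
      refine (Real.sin_pos_of_pos_of_lt_pi (by positivity) ?_).ne'
      rw [hθ, ← mul_div_assoc, div_lt_iff₀ hm]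
      nlinarith [Real.pi_pos]
    rcases Nat.even_or_odd' (M i j) with ⟨k, hk | hk⟩
    · have hk0 : (k : ℝ) ≠ 0 := by norm_cast; lia
      have hz : (S ℝ ((k : ℤ) - 1)).eval (2 * Real.cos θ) = 0 := by
        refine (mul_eq_zero.mp ?_).resolve_right hs
        rw [S_two_mul_real_cos]
        have : ((((k : ℤ) - 1 : ℤ) : ℝ) + 1) * θ = Real.pi := by
          rw [hθ, hk]; push_cast; field_simp; ring
        rw [this, Real.sin_pi]
      have e1 : ((M i j : ℤ) - 2) / 2 = (k : ℤ) - 1 := by lia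
      have e2 : ((M i j : ℤ) - 1) / 2 = (k : ℤ) - 1 := by lia
      rw [e1, e2, hz]
      simp
    · have hz : (S ℝ (k : ℤ)).eval (2 * Real.cos θ) +
          (S ℝ ((k : ℤ) - 1)).eval (2 * Real.cos θ) = 0 := by
        refine (mul_eq_zero.mp ?_).resolve_right hs
        rw [add_mul, S_two_mul_real_cos, S_two_mul_real_cos, Real.sin_add_sin]
        have : ((((k : ℤ) : ℝ) + 1) * θ + (((((k : ℤ) - 1 : ℤ) : ℝ) + 1) * θ)) / 2 = Real.pi := by
          rw [hθ, hk]; rw [hk] at hm; push_cast at hm ⊢; field_simp; ring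
        rw [this, Real.sin_pi]; simp
      have e1 : ((M i j : ℤ) - 2) / 2 = (k : ℤ) - 1 := by lia
      have e2 : ((M i j : ℤ) - 1) / 2 = (k : ℤ) := by lia
      have e3 : ((M i j : ℤ) - 3) / 2 = (k : ℤ) - 1 := by lia
      have e4 : (M i j : ℤ) / 2 = (k : ℤ) := by lia
      rw [e1, e2, e3, e4, hz]
      simp

end CoxeterMatrix

namespace CoxeterSystem

variable {B : Type*} {W : Type*} [Group W] {M : CoxeterMatrix B} (cs : CoxeterSystem M W)

theorem commute_simple_of_eq_two {i j : B} (h : M i j = 2) :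
    Commute (cs.simple i) (cs.simple j) := by
  have := cs.simple_mul_simple_pow i j
  rw [h, pow_two, mul_eq_one_iff_eq_inv, mul_inv_rev, cs.inv_simple, cs.inv_simple] at this
  exact this

/-- In a connected Coxeter graph, every proper nonempty set of vertices has an outgoing edge. -/
theorem exists_edge_of_connected (hconn : ¬ ∃ B₁ B₂ : Set B, B₁.Nonempty ∧ B₂.Nonempty ∧
      B₁ ∪ B₂ = Set.univ ∧ B₁ ∩ B₂ = ∅ ∧
      ∀ i ∈ B₁, ∀ j ∈ B₂, Commute (cs.simple i) (cs.simple j))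
    (s : Set B) {x y : B} (hx : x ∈ s) (hy : y ∉ s) : ∃ i ∈ s, ∃ j ∉ s, M i j ≠ 2 := by
  by_contra! H
  exact hconn ⟨s, sᶜ, ⟨x, hx⟩, ⟨y, hy⟩, Set.union_compl_self s, Set.inter_compl_self s,
    fun i hi j hj => cs.commute_simple_of_eq_two (H i hi j hj)⟩

variable [Fintype B] [DecidableEq B]

theorem _root_.CoxeterMatrix.isLiftable_reflection (M : CoxeterMatrix B) :
    M.IsLiftable fun i => Module.reflection (M.simpleCoroot_self i) :=
  M.reflection_mul_reflection_pow_eq_one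

/-- The geometric representation of a Coxeter group. -/
noncomputable def geometricRep : W →* ((B → ℝ) ≃ₗ[ℝ] (B → ℝ)) :=
  cs.lift ⟨fun i => Module.reflection (M.simpleCoroot_self i), M.isLiftable_reflection⟩

theorem geometricRep_simple (i : B) (v : B → ℝ) :
    cs.geometricRep (cs.simple i) v = v - (2 * M.titsForm (Pi.single i 1) v) • Pi.single i 1 := by
  rw [geometricRep, cs.lift_apply_simple, Module.reflection_apply]
  simp [CoxeterMatrix.simpleCoroot]

/-- The average over `W` of the standard inner product on `B → ℝ`. -/
noncomputable def averagedForm [Fintype W] (v w : B → ℝ) : ℝ :=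
  ∑ g : W, cs.geometricRep g v ⬝ᵥ cs.geometricRep g w

section

variable [Fintype W]

theorem averagedForm_pos {v : B → ℝ} (hv : v ≠ 0) : 0 < cs.averagedForm v v := by
  refine Finset.sum_pos' (fun g _ => ?_) ⟨1, Finset.mem_univ _, ?_⟩
  · exact Finset.sum_nonneg fun i _ => mul_self_nonneg _
  · rw [map_one]
    exact lt_of_le_of_ne (Finset.sum_nonneg fun i _ => mul_self_nonneg _)
      (fun h => hv (dotProduct_self_eq_zero.mp h.symm))

theorem averagedForm_comm (v w : B → ℝ) : cs.averagedForm v w = cs.averagedForm w v := by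
  simp only [averagedForm, dotProduct_comm]

theorem averagedForm_geometricRep (h : W) (v w : B → ℝ) :
    cs.averagedForm (cs.geometricRep h v) (cs.geometricRep h w) = cs.averagedForm v w := by
  unfold averagedForm
  refine Fintype.sum_equiv (Equiv.mulRight h) _ _ fun g => ?_
  simp [map_mul]

theorem averagedForm_single (i : B) (v : B → ℝ) :
    cs.averagedForm (Pi.single i 1) v =
      cs.averagedForm (Pi.single i 1) (Pi.single i 1) * M.titsForm (Pi.single i 1) v := by
  have h := cs.averagedForm_geometricRep (cs.simple i) (Pi.single i 1) v
  rw [geometricRep_simple, geometricRep_simple, M.titsForm_single, M.titsEntry_self] at h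
  have e : ∀ (c : ℝ), cs.averagedForm (Pi.single i 1 - (2 * 1 : ℝ) • Pi.single i 1)
      (v - c • Pi.single i 1) = - cs.averagedForm (Pi.single i 1) v
        + c * cs.averagedForm (Pi.single i 1) (Pi.single i 1) := by
    intro c
    simp only [averagedForm, map_sub, map_smul, sub_dotProduct, dotProduct_sub, smul_dotProduct,
      dotProduct_smul, Finset.mul_sum, ← Finset.sum_neg_distrib, ← Finset.sum_add_distrib,
      smul_eq_mul]
    refine Finset.sum_congr rfl fun g _ => ?_
    ring
  rw [e] at h
  linarith

theorem averagedForm_eq_sum (v w : B → ℝ) :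
    cs.averagedForm v w = ∑ i, v i * cs.averagedForm (Pi.single i 1) w := by
  conv_lhs => rw [pi_eq_sum_univ' v]
  simp only [averagedForm, map_sum, map_smul, sum_dotProduct, smul_dotProduct, Finset.mul_sum,
    smul_eq_mul]
  rw [Finset.sum_comm]

end

theorem titsForm_pos [Finite W] (hconn : ¬ ∃ B₁ B₂ : Set B, B₁.Nonempty ∧ B₂.Nonempty ∧
      B₁ ∪ B₂ = Set.univ ∧ B₁ ∩ B₂ = ∅ ∧
      ∀ i ∈ B₁, ∀ j ∈ B₂, Commute (cs.simple i) (cs.simple j))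
    {v : B → ℝ} (hv : v ≠ 0) : 0 < M.titsForm v v := by
  have := Fintype.ofFinite W
  let c : B → ℝ := fun i => cs.averagedForm (Pi.single i 1) (Pi.single i 1)
  obtain ⟨i₀, -⟩ := Function.ne_iff.mp hv
  have hc : ∀ i, c i = c i₀ := by
    by_contra! H
    obtain ⟨y, hy⟩ := H
    obtain ⟨i, hi, j, hj, hij⟩ := cs.exists_edge_of_connected hconn {i | c i = c i₀}
      (x := i₀) (y := y) rfl hy
    refine hj ((mul_right_cancel₀ (b := M.titsEntry i j) ?_ ?_).trans hi)
    · have : i ≠ j := by rintro rfl; exact hj hi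
      linarith [M.titsEntry_le_neg_half this hij]
    · have h1 := cs.averagedForm_single i (Pi.single j 1)
      have h2 := cs.averagedForm_single j (Pi.single i 1)
      rw [M.titsForm_single] at h1 h2
      rw [cs.averagedForm_comm, h2, M.titsEntry_symm] at h1
      exact h1
  have hpos : 0 < c i₀ := cs.averagedForm_pos (by simp)
  have key : cs.averagedForm v v = c i₀ * M.titsForm v v := by
    rw [averagedForm_eq_sum]
    have hsum : ∀ w, M.titsForm v w = ∑ i, v i * M.titsForm (Pi.single i 1) w := by
      intro w
      conv_lhs => rw [pi_eq_sum_univ' v]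
      simp
    rw [hsum, Finset.mul_sum]
    refine Finset.sum_congr rfl fun i _ => ?_
    rw [averagedForm_single]
    change v i * (c i * _) = _
    rw [hc]; ring
  have := cs.averagedForm_pos hv
  rw [key] at this
  exact pos_of_mul_pos_right this hpos.le

end CoxeterSystem

namespace CoxeterMatrix

variable {B : Type*} (M : CoxeterMatrix B)

theorem titsEntry_le_of_ne_three {i j : B} (h : i ≠ j) (h2 : M i j ≠ 2) (h3 : M i j ≠ 3) :
    M.titsEntry i j ≤ -(√2 / 2) := by
  have h1 := M.off_diagonal i j h
  rcases Nat.eq_zero_or_pos (M i j) with h0 | h0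
  · rw [M.titsEntry_of_eq_zero h0]
    nlinarith [Real.sq_sqrt (show (0 : ℝ) ≤ 2 by norm_num), Real.sqrt_nonneg 2]
  · have := M.titsEntry_le_of_le (n := 4) (by norm_num) (i := i) (j := j) (by lia)
    simpa using this

theorem titsEntry_le_of_even_of_ne_four {i j : B} (he : Even (M i j)) (h2 : M i j ≠ 2)
    (h4 : M i j ≠ 4) : M.titsEntry i j ≤ -(√3 / 2) := by
  rcases Nat.eq_zero_or_pos (M i j) with h0 | h0
  · rw [M.titsEntry_of_eq_zero h0]
    nlinarith [Real.sq_sqrt (show (0 : ℝ) ≤ 3 by norm_num), Real.sqrt_nonneg 3]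
  · have := M.titsEntry_le_of_le (n := 6) (by norm_num) (i := i) (j := j) (by grind)
    simpa using this

/-- Sets of vertices spanning a connected subgraph of the Coxeter graph. -/
inductive ConnectedFinset [DecidableEq B] : Finset B → Prop
  | singleton (x : B) : ConnectedFinset {x}
  | cons {T : Finset B} {x u : B} (hT : ConnectedFinset T) (hx : x ∈ T) (hu : u ∉ T)
      (hxu : M x u ≠ 2) : ConnectedFinset (insert u T)

/-- Reachability in the Coxeter graph along edges with odd labels. -/
def OddReachable : B → B → Prop := Relation.ReflTransGen fun i j => Odd (M i j)

variable {M}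

theorem OddReachable.symm {i j : B} (h : M.OddReachable i j) : M.OddReachable j i := by
  induction h with
  | refl => exact Relation.ReflTransGen.refl
  | tail _ hstep ih => exact Relation.ReflTransGen.head (by rwa [M.symmetric]) ih

theorem OddReachable.exists_odd_ne {i j : B} (h : M.OddReachable i j) (hij : j ≠ i) :
    ∃ k, k ≠ i ∧ Odd (M i k) := by
  by_contra! H
  refine hij ?_
  induction h with
  | refl => rfl
  | @tail y z _ hstep ih =>
    by_cases hy : y = i
    · subst hy
      exact absurd hstep (H z hij)
    · exact absurd (ih hy) hy

variable [Fintype B] [DecidableEq B]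

theorem ConnectedFinset.exists_oddReachable (M : CoxeterMatrix B) (x₀ : B) :
    ∃ T : Finset B, M.ConnectedFinset T ∧ ∀ x, x ∈ T ↔ M.OddReachable x₀ x := by
  let P : Set (Finset B) := {T | M.ConnectedFinset T ∧ x₀ ∈ T ∧ ∀ x ∈ T, M.OddReachable x₀ x}
  have hP : P.Nonempty := ⟨{x₀}, .singleton x₀, by simp, by
    simp only [Finset.mem_singleton, forall_eq]; exact Relation.ReflTransGen.refl⟩
  obtain ⟨T, hT⟩ := (Set.toFinite P).exists_maximal hP
  obtain ⟨hconn, h0, hsub⟩ := hT.prop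
  refine ⟨T, hconn, fun x => ⟨hsub x, fun hx => ?_⟩⟩
  induction hx with
  | refl => exact h0
  | @tail y z hy hyz ih =>
    by_contra hz
    have hne : M y z ≠ 2 := by intro h; rw [h] at hyz; exact absurd hyz (by decide)
    have : insert z T ∈ P := by
      refine ⟨hconn.cons ih hz hne, Finset.mem_insert_of_mem h0, fun x hx => ?_⟩
      rcases Finset.mem_insert.mp hx with rfl | hx
      · exact hy.tail hyz
      · exact hsub x hx
    exact hz (hT.le_of_ge this (Finset.subset_insert z T) (Finset.mem_insert_self z T))

/-- The sum of the simple roots indexed by `T`. -/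
def rootSum (T : Finset B) : B → ℝ := ∑ i ∈ T, Pi.single i 1

omit [Fintype B] in
theorem rootSum_apply (T : Finset B) (i : B) : rootSum T i = if i ∈ T then 1 else 0 := by
  simp [rootSum, Finset.sum_apply, Pi.single_apply]

theorem titsForm_rootSum (T : Finset B) (u : B) :
    M.titsForm (rootSum T) (Pi.single u 1) = ∑ i ∈ T, M.titsEntry i u := by
  simp [rootSum, titsForm_single]

theorem titsForm_rootSum_le {T : Finset B} {x u : B} (hx : x ∈ T) (hu : u ∉ T) :
    M.titsForm (rootSum T) (Pi.single u 1) ≤ M.titsEntry x u := by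
  rw [titsForm_rootSum, ← Finset.add_sum_erase _ _ hx]
  refine add_le_of_nonpos_right (Finset.sum_nonpos fun i hi => M.titsEntry_nonpos ?_)
  rintro rfl
  exact hu (Finset.mem_of_mem_erase hi)

theorem ConnectedFinset.titsForm_rootSum_self_le {T : Finset B} (hT : M.ConnectedFinset T) :
    M.titsForm (rootSum T) (rootSum T) ≤ 1 := by
  induction hT with
  | singleton x => simp [rootSum, titsForm_single]
  | @cons T x u hT hx hu hxu ih =>
    have e : rootSum (insert u T) = rootSum T + Pi.single u 1 := by
      rw [rootSum, Finset.sum_insert hu, add_comm]; rfl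
    have hne : x ≠ u := by rintro rfl; exact hu hx
    have h1 := (titsForm_rootSum_le (M := M) hx hu).trans (M.titsEntry_le_neg_half hne hxu)
    simp only [e, map_add, LinearMap.add_apply, M.titsForm_comm (Pi.single u 1) (rootSum T),
      titsForm_single, titsEntry_self]
    linarith

variable (hpos : ∀ v : B → ℝ, v ≠ 0 → 0 < M.titsForm v v)
include hpos

theorem ConnectedFinset.sq_add_sq_lt_one {T : Finset B} (hT : M.ConnectedFinset T)
    {x₁ x₂ u₁ u₂ : B} (hx₁ : x₁ ∈ T) (hx₂ : x₂ ∈ T) (hu₁ : u₁ ∉ T) (hu₂ : u₂ ∉ T)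
    (h₁₂ : u₁ ≠ u₂) {w₁ w₂ : ℝ} (hw₁ : 0 ≤ w₁) (hw₂ : 0 ≤ w₂)
    (h₁ : M.titsEntry x₁ u₁ ≤ -w₁) (h₂ : M.titsEntry x₂ u₂ ≤ -w₂) :
    w₁ ^ 2 + w₂ ^ 2 < 1 := by
  have hq := hT.titsForm_rootSum_self_le
  have k₁ := (titsForm_rootSum_le (M := M) hx₁ hu₁).trans h₁
  have k₂ := (titsForm_rootSum_le (M := M) hx₂ hu₂).trans h₂
  have hv := hpos (rootSum T + w₁ • Pi.single u₁ 1 + w₂ • Pi.single u₂ 1) (fun h => by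
    have := congrFun h x₁
    have n₁ : x₁ ≠ u₁ := by rintro rfl; exact hu₁ hx₁
    have n₂ : x₁ ≠ u₂ := by rintro rfl; exact hu₂ hx₁
    simp [rootSum_apply, hx₁, n₁, n₂] at this)
  simp only [map_add, map_smul, LinearMap.add_apply, LinearMap.smul_apply, smul_eq_mul,
    M.titsForm_comm (Pi.single _ 1) (rootSum T), titsForm_single, titsEntry_self,
    M.titsEntry_symm u₂ u₁] at hv
  have p₁₂ := M.titsEntry_nonpos h₁₂
  nlinarith [mul_nonneg (mul_nonneg hw₁ hw₂) (neg_nonneg.mpr p₁₂)]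

theorem ConnectedFinset.sq_add_sq_add_sq_lt_one {T : Finset B} (hT : M.ConnectedFinset T)
    {x₁ x₂ x₃ u₁ u₂ u₃ : B} (hx₁ : x₁ ∈ T) (hx₂ : x₂ ∈ T) (hx₃ : x₃ ∈ T)
    (hu₁ : u₁ ∉ T) (hu₂ : u₂ ∉ T) (hu₃ : u₃ ∉ T)
    (h₁₂ : u₁ ≠ u₂) (h₁₃ : u₁ ≠ u₃) (h₂₃ : u₂ ≠ u₃) {w₁ w₂ w₃ : ℝ}
    (hw₁ : 0 ≤ w₁) (hw₂ : 0 ≤ w₂) (hw₃ : 0 ≤ w₃)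
    (h₁ : M.titsEntry x₁ u₁ ≤ -w₁) (h₂ : M.titsEntry x₂ u₂ ≤ -w₂)
    (h₃ : M.titsEntry x₃ u₃ ≤ -w₃) :
    w₁ ^ 2 + w₂ ^ 2 + w₃ ^ 2 < 1 := by
  have hq := hT.titsForm_rootSum_self_le
  have k₁ := mul_le_mul_of_nonneg_left ((titsForm_rootSum_le (M := M) hx₁ hu₁).trans h₁) hw₁
  have k₂ := mul_le_mul_of_nonneg_left ((titsForm_rootSum_le (M := M) hx₂ hu₂).trans h₂) hw₂
  have k₃ := mul_le_mul_of_nonneg_left ((titsForm_rootSum_le (M := M) hx₃ hu₃).trans h₃) hw₃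
  have hv := hpos (rootSum T + w₁ • Pi.single u₁ 1 + w₂ • Pi.single u₂ 1 + w₃ • Pi.single u₃ 1)
    (fun h => by
      have := congrFun h x₁
      have n₁ : x₁ ≠ u₁ := by rintro rfl; exact hu₁ hx₁
      have n₂ : x₁ ≠ u₂ := by rintro rfl; exact hu₂ hx₁
      have n₃ : x₁ ≠ u₃ := by rintro rfl; exact hu₃ hx₁
      simp [rootSum_apply, hx₁, n₁, n₂, n₃] at this)
  simp only [map_add, map_smul, LinearMap.add_apply, LinearMap.smul_apply, smul_eq_mul,
    M.titsForm_comm (Pi.single _ 1) (rootSum T), titsForm_single, titsEntry_self,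
    M.titsEntry_symm u₂ u₁, M.titsEntry_symm u₃ u₁, M.titsEntry_symm u₃ u₂] at hv
  have p₁₂ := mul_nonneg (mul_nonneg hw₁ hw₂) (neg_nonneg.mpr (M.titsEntry_nonpos h₁₂))
  have p₁₃ := mul_nonneg (mul_nonneg hw₁ hw₃) (neg_nonneg.mpr (M.titsEntry_nonpos h₁₃))
  have p₂₃ := mul_nonneg (mul_nonneg hw₂ hw₃) (neg_nonneg.mpr (M.titsEntry_nonpos h₂₃))
  linarith

/-- The affine diagram of type `F₄` is not positive definite. -/
theorem not_affine_F₄ {p q r s t : B} (hpq : M p q ≠ 2) (hqr : M q r ≠ 2) (hrs : M r s ≠ 2)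
    (hrs' : M r s ≠ 3) (hst : M s t ≠ 2) (hnd : [p, q, r, s, t].Nodup) : False := by
  simp only [List.nodup_cons, List.mem_cons, List.not_mem_nil, not_or, or_false] at hnd
  obtain ⟨⟨n1, n2, n3, n4⟩, ⟨n5, n6, n7⟩, ⟨n8, n9⟩, n10, -⟩ := hnd
  have hs := Real.sq_sqrt (show (0 : ℝ) ≤ 2 by norm_num)
  have hs0 := Real.sqrt_nonneg 2
  have hv := hpos (Pi.single p 1 + (2 : ℝ) • Pi.single q 1 + (3 : ℝ) • Pi.single r 1 +
      (2 * √2) • Pi.single s 1 + √2 • Pi.single t 1) (fun h => by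
    have := congrFun h p
    simp [n1, n2, n3, n4] at this)
  simp only [map_add, map_smul, LinearMap.add_apply, LinearMap.smul_apply, smul_eq_mul,
    titsForm_single, titsEntry_self, M.titsEntry_symm q p, M.titsEntry_symm r p,
    M.titsEntry_symm s p, M.titsEntry_symm t p, M.titsEntry_symm r q, M.titsEntry_symm s q,
    M.titsEntry_symm t q, M.titsEntry_symm s r, M.titsEntry_symm t r,
    M.titsEntry_symm t s] at hv
  have e1 := M.titsEntry_le_neg_half n1 hpq
  have e2 := M.titsEntry_le_neg_half n5 hqr
  have e3 := mul_le_mul_of_nonneg_left (M.titsEntry_le_of_ne_three n8 hrs hrs') hs0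
  have e4 := M.titsEntry_le_neg_half n10 hst
  have z1 := M.titsEntry_nonpos n2
  have z2 := mul_nonpos_of_nonneg_of_nonpos hs0 (M.titsEntry_nonpos n3)
  have z3 := mul_nonpos_of_nonneg_of_nonpos hs0 (M.titsEntry_nonpos n4)
  have z4 := mul_nonpos_of_nonneg_of_nonpos hs0 (M.titsEntry_nonpos n6)
  have z5 := mul_nonpos_of_nonneg_of_nonpos hs0 (M.titsEntry_nonpos n7)
  have z6 := mul_nonpos_of_nonneg_of_nonpos hs0 (M.titsEntry_nonpos n9)
  ring_nf at hv hs e3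
  rw [hs] at hv e3
  linarith

/-- Every nonempty set of vertices has a vertex with at most one neighbour in the set. -/
theorem exists_leaf {T : Finset B} (hT : T.Nonempty) :
    ∃ u ∈ T, ∀ x ∈ T, ∀ y ∈ T, x ≠ u → y ≠ u → M u x ≠ 2 → M u y ≠ 2 → x = y := by
  by_contra! H
  obtain ⟨t, ht⟩ := hT
  have hv := hpos (rootSum T) (fun h => by
    have := congrFun h t
    simp [rootSum_apply, ht] at this)
  refine hv.not_ge ?_
  have : M.titsForm (rootSum T) (rootSum T) = ∑ u ∈ T, M.titsForm (rootSum T) (Pi.single u 1) := by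
    conv_lhs => enter [2]; rw [rootSum]
    rw [map_sum]
  rw [this]
  refine Finset.sum_nonpos fun u hu => ?_
  obtain ⟨x, hx, y, hy, hxu, hyu, hux, huy, hxy⟩ := H u hu
  rw [titsForm_rootSum, ← Finset.add_sum_erase _ _ hu,
    ← Finset.add_sum_erase _ _ (Finset.mem_erase.mpr ⟨hxu, hx⟩),
    ← Finset.add_sum_erase _ _ (Finset.mem_erase.mpr
      ⟨hxy.symm, Finset.mem_erase.mpr ⟨hyu, hy⟩⟩), titsEntry_self]
  have h1 := M.titsEntry_le_neg_half hxu (by rwa [M.symmetric])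
  have h2 := M.titsEntry_le_neg_half hyu (by rwa [M.symmetric])
  have h3 : ∑ i ∈ ((T.erase u).erase x).erase y, M.titsEntry i u ≤ 0 :=
    Finset.sum_nonpos fun i hi => M.titsEntry_nonpos (by grind)
  linarith

/-- The Coxeter graph is a forest, so every system of signs on its edges is a coboundary. -/
theorem exists_signs {G : Type*} [CommGroup G] (c : B → B → G) (hc : ∀ i j, c i j ^ 2 = 1)
    (hsymm : ∀ i j, c i j = c j i) :
    ∃ ε : B → G, (∀ i, ε i ^ 2 = 1) ∧ ∀ i j, i ≠ j → M i j ≠ 2 → ε i * ε j = c i j := by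
  suffices H : ∀ (n : ℕ) (T : Finset B), T.card = n → ∃ ε : B → G, (∀ i, ε i ^ 2 = 1) ∧
      ∀ i ∈ T, ∀ j ∈ T, i ≠ j → M i j ≠ 2 → ε i * ε j = c i j by
    obtain ⟨ε, h1, h2⟩ := H _ Finset.univ rfl
    exact ⟨ε, h1, fun i j => h2 i (Finset.mem_univ i) j (Finset.mem_univ j)⟩
  intro n
  induction n with
  | zero =>
    intro T hT
    rw [Finset.card_eq_zero] at hT
    exact ⟨1, by simp, by simp [hT]⟩
  | succ n ih =>
    intro T hT
    obtain ⟨u, hu, hleaf⟩ := exists_leaf hpos (T := T) (by rw [← Finset.card_pos]; lia)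
    obtain ⟨ε, h1, h2⟩ := ih (T.erase u) (by rw [Finset.card_erase_of_mem hu]; lia)
    have key : ∀ d : G, d ^ 2 = 1 →
        (∀ j ∈ T, j ≠ u → M u j ≠ 2 → d * ε j = c u j) →
        ∃ ε : B → G, (∀ i, ε i ^ 2 = 1) ∧
          ∀ i ∈ T, ∀ j ∈ T, i ≠ j → M i j ≠ 2 → ε i * ε j = c i j := by
      intro d hd hdu
      refine ⟨Function.update ε u d, fun i => ?_, fun i hi j hj hij hm => ?_⟩
      · by_cases hiu : i = u
        · subst hiu; simpa using hd
        · simpa [hiu] using h1 i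
      · by_cases hiu : i = u
        · subst hiu
          simpa [hij.symm] using hdu j hj hij.symm hm
        · by_cases hju : j = u
          · subst hju
            rw [hsymm, mul_comm]
            simpa [hij] using hdu i hi hij (by rwa [M.symmetric])
          · simpa [hiu, hju] using
              h2 i (Finset.mem_erase.mpr ⟨hiu, hi⟩) j (Finset.mem_erase.mpr ⟨hju, hj⟩) hij hm
    by_cases hex : ∃ x ∈ T, x ≠ u ∧ M u x ≠ 2
    · obtain ⟨x, hx, hxu, hux⟩ := hex
      refine key (c u x * (ε x)⁻¹) (by rw [mul_pow, inv_pow, hc, h1]; simp) fun j hj hju hm => ?_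
      rw [hleaf j hj x hx hju hxu hm hux, inv_mul_cancel_right]
    · push Not at hex
      exact key 1 (one_pow 2) fun j hj hju hm => absurd (hex j hj hju) hm

end CoxeterMatrix

namespace CoxeterMatrix

variable {B : Type*} {M : CoxeterMatrix B}

theorem injective_of_entry {n : ℕ} {N : CoxeterMatrix (Fin n)} {v : Fin n → B}
    (h : ∀ p q, M (v p) (v q) = N p q) : Function.Injective v := by
  intro p q hpq
  by_contra hne
  refine N.off_diagonal p q hne ?_
  rw [← h, hpq, M.diagonal]

theorem B_succ_succ (n : ℕ) (p q : Fin (n + 2)) :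
    CoxeterMatrix.B (n + 3) p.succ q.succ = CoxeterMatrix.B (n + 2) p q := by
  simp only [CoxeterMatrix.B, Matrix.of_apply, Fin.succ_inj, Fin.val_succ]
  congr 1
  congr 1
  · simp only [eq_iff_iff]; lia
  · congr 1
    simp only [eq_iff_iff]; lia

theorem B_zero_succ (n : ℕ) (q : Fin (n + 2)) :
    CoxeterMatrix.B (n + 3) 0 q.succ = if q = 0 then 3 else 2 := by
  have h : (0 : Fin (n + 3)) ≠ q.succ := (Fin.succ_ne_zero q).symm
  have h4 : ¬ (0 = n + 3 - 1 ∧ (q : ℕ) + 1 = n + 3 - 2 ∨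
      (q : ℕ) + 1 = n + 3 - 1 ∧ 0 = n + 3 - 2) := by lia
  have h3 : ((q : ℕ) + 1 + 1 = 0 ∨ 0 + 1 = (q : ℕ) + 1) ↔ q = 0 := by
    rw [Fin.ext_iff, Fin.val_zero]; lia
  simp only [CoxeterMatrix.B, Matrix.of_apply, h, if_false, Fin.val_succ, Fin.val_zero, h4, h3]

variable [Fintype B] [DecidableEq B]
  (hpos : ∀ v : B → ℝ, v ≠ 0 → 0 < M.titsForm v v)
include hpos

theorem ConnectedFinset.eq_of_not_odd {T : Finset B} (hT : M.ConnectedFinset T)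
    {x₁ x₂ u₁ u₂ : B} (hx₁ : x₁ ∈ T) (hx₂ : x₂ ∈ T) (hu₁ : u₁ ∉ T) (hu₂ : u₂ ∉ T)
    (h₁ : M x₁ u₁ ≠ 2) (h₁' : M x₁ u₁ ≠ 3) (h₂ : M x₂ u₂ ≠ 2) (h₂' : M x₂ u₂ ≠ 3) :
    u₁ = u₂ := by
  by_contra hne
  have := hT.sq_add_sq_lt_one hpos hx₁ hx₂ hu₁ hu₂ hne (w₁ := √2 / 2) (w₂ := √2 / 2)
    (by positivity) (by positivity)
    (M.titsEntry_le_of_ne_three (by rintro rfl; exact hu₁ hx₁) h₁ h₁')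
    (M.titsEntry_le_of_ne_three (by rintro rfl; exact hu₂ hx₂) h₂ h₂')
  have hs := Real.sq_sqrt (show (0 : ℝ) ≤ 2 by norm_num)
  linarith

theorem ConnectedFinset.eq_of_branch {T : Finset B} (hT : M.ConnectedFinset T)
    {x₁ x₂ x₃ u₁ u₂ u₃ : B} (hx₁ : x₁ ∈ T) (hx₂ : x₂ ∈ T) (hx₃ : x₃ ∈ T)
    (hu₁ : u₁ ∉ T) (hu₂ : u₂ ∉ T) (hu₃ : u₃ ∉ T) (h₁₂ : u₁ ≠ u₂) (h₁₃ : u₁ ≠ u₃)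
    (h₁ : M x₁ u₁ ≠ 2) (h₁' : M x₁ u₁ ≠ 3) (h₂ : M x₂ u₂ ≠ 2) (h₃ : M x₃ u₃ ≠ 2) :
    u₂ = u₃ := by
  by_contra hne
  have := hT.sq_add_sq_add_sq_lt_one hpos hx₁ hx₂ hx₃ hu₁ hu₂ hu₃ h₁₂ h₁₃ hne
    (w₁ := √2 / 2) (w₂ := 1 / 2) (w₃ := 1 / 2)
    (by positivity) (by positivity) (by positivity)
    (M.titsEntry_le_of_ne_three (by rintro rfl; exact hu₁ hx₁) h₁ h₁')
    (M.titsEntry_le_neg_half (by rintro rfl; exact hu₂ hx₂) h₂)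
    (M.titsEntry_le_neg_half (by rintro rfl; exact hu₃ hx₃) h₃)
  have hs := Real.sq_sqrt (show (0 : ℝ) ≤ 2 by norm_num)
  linarith

theorem eq_four_of_even {a b c : B} (he : Even (M b a)) (h2 : M b a ≠ 2) (hcb : c ≠ b)
    (hca : c ≠ a) (hc : M b c ≠ 2) : M b a = 4 := by
  by_contra h4
  have hba : b ≠ a := by rintro rfl; simp at he
  have := (ConnectedFinset.singleton (M := M) b).sq_add_sq_lt_one hpos
    (Finset.mem_singleton_self b) (Finset.mem_singleton_self b)
    (by simpa using hba.symm) (by simpa using hcb) hca.symm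
    (w₁ := √3 / 2) (w₂ := 1 / 2) (by positivity) (by positivity)
    (M.titsEntry_le_of_even_of_ne_four he h2 h4) (M.titsEntry_le_neg_half hcb.symm hc)
  have hs := Real.sq_sqrt (show (0 : ℝ) ≤ 3 by norm_num)
  linarith

end CoxeterMatrix

namespace CoxeterMatrix

variable {B : Type*} {M : CoxeterMatrix B} [DecidableEq B]

/-- A chain of type `B` in a Coxeter graph ending with the edge from `b` to `a`, such that only
`a` and the initial vertex may have further neighbours. The set `T` consists of the vertices of the
chain other than `a`. -/
structure IsBChain (M : CoxeterMatrix B) (a b : B) (n : ℕ) (v : Fin (n + 2) → B)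
    (T : Finset B) : Prop where
  entry (p q : Fin (n + 2)) : M (v p) (v q) = CoxeterMatrix.B (n + 2) p q
  last : v (Fin.last (n + 1)) = a
  penultimate : v (Fin.last n).castSucc = b
  connected : M.ConnectedFinset T
  oddReachable (x : B) : x ∈ T → M.OddReachable b x
  mem_iff (x : B) : x ∈ T ↔ x ∈ Set.range v ∧ x ≠ a
  closed (x : B) : x ∈ T → x ≠ v 0 → ∀ y, M x y ≠ 2 → y ∈ T ∨ y = a

theorem IsBChain.zero_mem {a b : B} {n : ℕ} {v : Fin (n + 2) → B} {T : Finset B}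
    (h : M.IsBChain a b n v T) : v 0 ∈ T := by
  refine (h.mem_iff _).mpr ⟨⟨0, rfl⟩, ?_⟩
  rw [← h.last]
  exact (injective_of_entry h.entry).ne (Fin.last_pos).ne

theorem IsBChain.base {a b : B} (hab : M b a = 4) : M.IsBChain a b 0 ![b, a] {b} where
  entry p q := by
    have hab' : M a b = 4 := by rwa [M.symmetric]
    fin_cases p <;> fin_cases q <;> simp [CoxeterMatrix.B, hab, hab']
  last := rfl
  penultimate := rfl
  connected := .singleton b
  oddReachable x hx := by
    rw [Finset.mem_singleton.mp hx]; exact Relation.ReflTransGen.refl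
  mem_iff x := by
    have : b ≠ a := by rintro rfl; simp at hab
    simp only [Finset.mem_singleton, Matrix.range_cons, Matrix.range_empty, Set.union_empty,
      Set.singleton_union, Set.mem_insert_iff, Set.mem_singleton_iff]
    grind
  closed x hx hne := absurd (Finset.mem_singleton.mp hx) hne

theorem IsBChain.cons [Fintype B] (hpos : ∀ v : B → ℝ, v ≠ 0 → 0 < M.titsForm v v)
    {a b : B} (hab : M b a = 4) (ha : ¬ M.OddReachable b a)
    (hC : ∀ x u, M.OddReachable b x → ¬ M.OddReachable b u → M x u ≠ 2 → u = a)
    (hA : ∀ x, M.OddReachable b x → M x a ≠ 2 → x = b)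
    {n : ℕ} {v : Fin (n + 2) → B} {T : Finset B} (h : M.IsBChain a b n v T)
    {u : B} (hu : u ∉ T) (hua : u ≠ a) (hvu : M (v 0) u ≠ 2) :
    M.IsBChain a b (n + 1) (Fin.cons u v) (insert u T) := by
  have hinj := injective_of_entry h.entry
  have h0 := h.zero_mem
  have haT : a ∉ T := fun hm => ha (h.oddReachable a hm)
  have hbT : b ∈ T := by
    refine (h.mem_iff b).mpr ⟨⟨_, h.penultimate⟩, ?_⟩
    rintro rfl; simp at hab
  have huC : M.OddReachable b u := by
    by_contra hn
    exact hua (hC _ u (h.oddReachable _ h0) hn hvu)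
  have h3 : M (v 0) u = 3 := by
    by_contra h3
    exact hua (h.connected.eq_of_not_odd hpos hbT h0 haT hu (by lia) (by lia) hvu h3).symm
  have hrow : ∀ q, M u (v q) = if q = 0 then 3 else 2 := by
    intro q
    split_ifs with hq
    · rw [hq, M.symmetric, h3]
    · by_contra hne
      by_cases hqa : v q = a
      · rw [hqa] at hne
        exact hu (hA u huC hne ▸ hbT)
      · have hqT := (h.mem_iff _).mpr ⟨⟨q, rfl⟩, hqa⟩
        rcases h.closed _ hqT (hinj.ne hq) u (by rwa [M.symmetric]) with h' | h'
        exacts [hu h', hua h']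
  refine ⟨fun p q => ?_, h.last, h.penultimate, h.connected.cons h0 hu hvu, fun x hx => ?_,
    fun x => ?_, fun x hx hxu y hxy => ?_⟩
  · refine Fin.cases ?_ (fun p => ?_) p <;> refine Fin.cases ?_ (fun q => ?_) q
    · rw [CoxeterMatrix.diagonal, CoxeterMatrix.diagonal]
    · rw [B_zero_succ, Fin.cons_zero, Fin.cons_succ, hrow]
    · rw [CoxeterMatrix.symmetric _ p.succ, B_zero_succ, Fin.cons_zero, Fin.cons_succ,
        M.symmetric, hrow]
    · rw [B_succ_succ, Fin.cons_succ, Fin.cons_succ, h.entry]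
  · rcases Finset.mem_insert.mp hx with rfl | hx
    exacts [huC, h.oddReachable x hx]
  · rw [Finset.mem_insert, h.mem_iff, Fin.range_cons, Set.mem_insert_iff]
    grind
  · rw [Fin.cons_zero] at hxu
    have hxT := Finset.mem_of_mem_insert_of_ne hx hxu
    by_cases hx0 : x = v 0
    · by_contra! H
      refine H.1 (Finset.mem_insert.mpr (Or.inl ?_))
      have hyT : y ∉ T := fun hm => H.1 (Finset.mem_insert_of_mem hm)
      exact (h.connected.eq_of_branch hpos hbT h0 h0 haT hu hyT hua.symm (Ne.symm H.2)
        (by lia) (by lia) hvu (by rwa [← hx0])).symm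
    · exact (h.closed x hxT hx0 y hxy).imp_left Finset.mem_insert_of_mem

theorem exists_reindex_eq_B [Fintype B] (hpos : ∀ v : B → ℝ, v ≠ 0 → 0 < M.titsForm v v)
    (hconn : ∀ (s : Set B) (x y : B), x ∈ s → y ∉ s → ∃ i ∈ s, ∃ j ∉ s, M i j ≠ 2)
    {i₀ i j : B} (hi : ¬ M.OddReachable i₀ i) (hj : ¬ M.OddReachable i₀ j) (hij : i ≠ j)
    (he : Even (M i j)) :
    ∃ (n : ℕ) (e : B ≃ Fin n), M.reindex e = CoxeterMatrix.B n := by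
  obtain ⟨a, ha : M.OddReachable i₀ a, b, hb : ¬ M.OddReachable i₀ b, hab⟩ :=
    hconn {x | M.OddReachable i₀ x} i₀ i Relation.ReflTransGen.refl hi
  have hodd : ∀ {c x u : B}, M.OddReachable c x → ¬ M.OddReachable c u → ¬ Odd (M x u) :=
    fun hx hu h => hu (hx.tail h)
  have h3 : ∀ {c x u : B}, M.OddReachable c x → ¬ M.OddReachable c u → M x u ≠ 3 :=
    fun hx hu h => hodd hx hu (by rw [h]; decide)
  have hdisj : ∀ {x : B}, M.OddReachable b x → ¬ M.OddReachable i₀ x :=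
    fun hx h => hb (h.trans hx.symm)
  have hbb : M.OddReachable b b := Relation.ReflTransGen.refl
  have hCa : ¬ M.OddReachable b a := fun h => hdisj h ha
  have hba : M b a ≠ 2 := by rwa [M.symmetric]
  obtain ⟨A, hA, hAmem⟩ := ConnectedFinset.exists_oddReachable M i₀
  obtain ⟨C, hC, hCmem⟩ := ConnectedFinset.exists_oddReachable M b
  have hAout : ∀ x u, M.OddReachable i₀ x → ¬ M.OddReachable i₀ u → M x u ≠ 2 → u = b := by
    intro x u hx hu hxu
    exact hA.eq_of_not_odd hpos ((hAmem x).mpr hx) ((hAmem a).mpr ha)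
      (by rwa [hAmem]) (by rwa [hAmem]) hxu (h3 hx hu) hab (h3 ha hb)
  have hCout : ∀ x u, M.OddReachable b x → ¬ M.OddReachable b u → M x u ≠ 2 → u = a := by
    intro x u hx hu hxu
    exact hC.eq_of_not_odd hpos ((hCmem x).mpr hx) ((hCmem b).mpr hbb)
      (by rwa [hCmem]) (by rwa [hCmem]) hxu (h3 hx hu) hba (h3 hbb hCa)
  have hcover : ∀ x, M.OddReachable i₀ x ∨ M.OddReachable b x := by
    by_contra! H
    obtain ⟨y, hy⟩ := H
    obtain ⟨x, hx, u, hu, hxu⟩ := hconn {x | M.OddReachable i₀ x ∨ M.OddReachable b x} a y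
      (Or.inl ha) (by simpa using hy)
    simp only [Set.mem_ofPred_eq, not_or] at hx hu
    rcases hx with hx | hx
    · exact hu.2 (hAout x u hx hu.1 hxu ▸ hbb)
    · exact hu.1 (hCout x u hx hu.2 hxu ▸ ha)
  have hiC := (hcover i).resolve_left hi
  have hjC := (hcover j).resolve_left hj
  have hab4 : M b a = 4 := by
    obtain ⟨k, hk, hkb⟩ : ∃ k, M.OddReachable b k ∧ k ≠ b := by
      by_cases hib : i = b
      · exact ⟨j, hjC, by rw [← hib]; exact hij.symm⟩
      · exact ⟨i, hiC, hib⟩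
    obtain ⟨c, hcb, hc⟩ := hk.exists_odd_ne hkb
    refine eq_four_of_even hpos (Nat.not_odd_iff_even.mp (hodd hbb hCa)) hba hcb ?_ ?_
    · rintro rfl; exact hodd hbb hCa hc
    · intro h; rw [h] at hc; exact absurd hc (by decide)
  have hCA : ∀ x, M.OddReachable b x → M x a ≠ 2 → x = b := fun x hx hxa =>
    hAout a x ha (hdisj hx) (by rwa [M.symmetric])
  obtain ⟨n, v, T, h, hmax⟩ : ∃ (n : ℕ) (v : Fin (n + 2) → B) (T : Finset B),
      M.IsBChain a b n v T ∧ ∀ u, u ∉ T → u ≠ a → M (v 0) u = 2 := by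
    by_contra! H
    have hall : ∀ n, ∃ (v : Fin (n + 2) → B) (T : Finset B), M.IsBChain a b n v T := by
      intro n
      induction n with
      | zero => exact ⟨_, _, IsBChain.base hab4⟩
      | succ n ih =>
        obtain ⟨v, T, h⟩ := ih
        obtain ⟨u, hu, hua, hvu⟩ := H n v T h
        exact ⟨_, _, h.cons hpos hab4 hCa hCout hCA hu hua hvu⟩
    obtain ⟨v, T, h⟩ := hall (Fintype.card B)
    have := Fintype.card_le_of_injective v (injective_of_entry h.entry)
    simp at this
  have hinj := injective_of_entry h.entry
  have hbT : b ∈ T := (h.mem_iff b).mpr ⟨⟨_, h.penultimate⟩, by rintro rfl; simp at hab4⟩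
  have hCT : ∀ x, M.OddReachable b x → x ∈ T := by
    intro x hx
    induction hx with
    | refl => exact hbT
    | @tail y z hy hyz ih =>
      have hza : z ≠ a := by
        rintro rfl
        exact hCa (hy.tail hyz)
      have hne : M y z ≠ 2 := by intro h; rw [h] at hyz; exact absurd hyz (by decide)
      by_contra hz
      by_cases hy0 : y = v 0
      · exact hne (hy0 ▸ hmax z hz hza)
      · exact (h.closed y ih hy0 z hne).elim hz hza
  have hAa : ∀ x, M.OddReachable i₀ x → x = a := by
    by_contra! H
    obtain ⟨x, hx, hxa⟩ := H
    obtain ⟨u, hua, hu⟩ := OddReachable.exists_odd_ne (ha.symm.trans hx) hxa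
    have huA : M.OddReachable i₀ u := ha.tail hu
    have hrange : ∀ x, M.OddReachable b x → ∃ p, v p = x ∧ p ≠ Fin.last (n + 1) := by
      intro x hx
      obtain ⟨⟨p, hp⟩, hxa⟩ := (h.mem_iff x).mp (hCT x hx)
      refine ⟨p, hp, ?_⟩
      rintro rfl
      exact hxa (hp ▸ h.last)
    obtain ⟨p, rfl, hp⟩ := hrange i hiC
    obtain ⟨q, rfl, hq⟩ := hrange j hjC
    have hpq : p ≠ q := fun e => hij (e ▸ rfl)
    obtain rfl | rfl | ⟨n, rfl⟩ : n = 0 ∨ n = 1 ∨ ∃ n', n = n' + 2 := by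
      rcases n with _ | _ | n
      exacts [Or.inl rfl, Or.inr (Or.inl rfl), Or.inr (Or.inr ⟨n, rfl⟩)]
    · simp only [ne_eq, Fin.ext_iff, Fin.val_last] at hp hq hpq
      lia
    · rw [h.entry] at he
      simp only [CoxeterMatrix.B, Matrix.of_apply, hpq, if_false] at he
      simp only [ne_eq, Fin.ext_iff, Fin.val_last] at hp hq hpq
      split_ifs at he
      exacts [by lia, absurd he (by decide), by lia]
    · have hm : ∀ x, x ∈ T → x ≠ u := by
        rintro x hx rfl
        exact hdisj (h.oddReachable x hx) huA
      have hT : ∀ r, r ≠ Fin.last (n + 3) → v r ≠ u := fun r hr =>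
        hm _ ((h.mem_iff _).mpr ⟨⟨r, rfl⟩, h.last ▸ hinj.ne hr⟩)
      have hsub : ∀ r s : Fin (n + 4), r ≠ s → (r : ℕ) + 1 = s → M (v r) (v s) ≠ 2 := by
        intro r s hrs hrs'
        rw [h.entry]
        simp only [CoxeterMatrix.B, Matrix.of_apply, hrs, if_false]
        split_ifs <;> lia
      have hlast := h.last
      have hpen := h.penultimate
      refine not_affine_F₄ hpos (p := v ⟨n, by lia⟩) (q := v ⟨n + 1, by lia⟩) (r := b) (s := a)
        (t := u) (hsub _ _ (by simp) rfl) ?_ hba (by lia) ?_ ?_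
      · rw [← hpen]
        exact hsub _ _ (by simp [Fin.ext_iff]) rfl
      · intro h2; rw [h2] at hu; exact absurd hu (by decide)
      · rw [← hpen, ← hlast]
        rw [← hlast] at hua
        simp only [List.nodup_cons, List.mem_cons, List.not_mem_nil, or_false, not_or, hinj.eq_iff,
          Fin.ext_iff, Fin.val_castSucc, Fin.val_last, not_false_iff, List.nodup_nil, and_true]
        refine ⟨⟨by lia, by lia, by lia, hT _ ?_⟩, ⟨by lia, by lia, hT _ ?_⟩, ⟨by lia, hT _ ?_⟩,
          hua.symm⟩ <;> simp [Fin.ext_iff]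
  have hsurj : Function.Surjective v := by
    intro x
    rcases hcover x with hx | hx
    · exact ⟨_, h.last.trans (hAa x hx).symm⟩
    · exact ((h.mem_iff x).mp (hCT x hx)).1
  refine ⟨n + 2, (Equiv.ofBijective v ⟨hinj, hsurj⟩).symm, ?_⟩
  ext p q
  exact h.entry p q

end CoxeterMatrix

namespace IsTwoCocycle

variable {G : Type*} [Group G] {ψ : G → G → ℂˣ}

theorem one_left (hψ : IsTwoCocycle ψ) (g : G) : ψ 1 g = ψ 1 1 := by
  have := hψ 1 1 g
  simp only [one_mul] at this
  exact (mul_right_cancel this).symm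

theorem one_right (hψ : IsTwoCocycle ψ) (g : G) : ψ g 1 = ψ 1 1 := by
  have := hψ g 1 1
  simp only [mul_one] at this
  exact mul_right_cancel this

end IsTwoCocycle

/-- The central extension of `G` by `ℂˣ` defined by a 2-cocycle `ψ`. -/
@[ext]
structure CocycleExtension {G : Type*} [Group G] (ψ : G → G → ℂˣ) (hψ : IsTwoCocycle ψ) where
  /-- The underlying element of the group `G`. -/
  base : G
  /-- The scalar component. -/
  scalar : ℂˣ

namespace CocycleExtension

variable {G : Type*} [Group G] {ψ : G → G → ℂˣ} {hψ : IsTwoCocycle ψ}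

instance : Mul (CocycleExtension ψ hψ) :=
  ⟨fun x y => ⟨x.base * y.base, x.scalar * y.scalar * ψ x.base y.base⟩⟩

instance : One (CocycleExtension ψ hψ) := ⟨⟨1, (ψ 1 1)⁻¹⟩⟩

instance : Inv (CocycleExtension ψ hψ) :=
  ⟨fun x => ⟨x.base⁻¹, x.scalar⁻¹ * (ψ x.base⁻¹ x.base)⁻¹ * (ψ 1 1)⁻¹⟩⟩

@[simp] theorem mul_base (x y : CocycleExtension ψ hψ) : (x * y).base = x.base * y.base := rfl

@[simp] theorem mul_scalar (x y : CocycleExtension ψ hψ) :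
    (x * y).scalar = x.scalar * y.scalar * ψ x.base y.base := rfl

@[simp] theorem one_base : (1 : CocycleExtension ψ hψ).base = 1 := rfl

@[simp] theorem one_scalar : (1 : CocycleExtension ψ hψ).scalar = (ψ 1 1)⁻¹ := rfl

@[simp] theorem inv_base (x : CocycleExtension ψ hψ) : x⁻¹.base = x.base⁻¹ := rfl

@[simp] theorem inv_scalar (x : CocycleExtension ψ hψ) :
    x⁻¹.scalar = x.scalar⁻¹ * (ψ x.base⁻¹ x.base)⁻¹ * (ψ 1 1)⁻¹ := rfl

instance : Group (CocycleExtension ψ hψ) :=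
  Group.ofLeftAxioms
    (fun x y z => by
      ext1
      · exact mul_assoc _ _ _
      · have := hψ x.base y.base z.base
        calc x.scalar * y.scalar * ψ x.base y.base * z.scalar * ψ (x.base * y.base) z.base
            = x.scalar * y.scalar * z.scalar *
              (ψ x.base y.base * ψ (x.base * y.base) z.base) := by ac_rfl
          _ = x.scalar * (y.scalar * z.scalar * ψ y.base z.base) * ψ x.base (y.base * z.base) := by
            rw [this]; ac_rfl)
    (fun x => by
      ext1
      · exact one_mul _
      · simp [hψ.one_left])
    (fun x => by
      ext1
      · exact inv_mul_cancel _
      · simp only [mul_scalar, inv_scalar, inv_base, one_scalar]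
        rw [mul_right_comm _ (ψ 1 1)⁻¹, mul_right_comm _ (ψ 1 1)⁻¹, mul_right_comm x.scalar⁻¹]
        simp)

variable (ψ hψ) in
/-- The projection of the central extension onto the group. -/
def proj : CocycleExtension ψ hψ →* G where
  toFun := base
  map_one' := rfl
  map_mul' _ _ := rfl

@[simp] theorem proj_apply (x : CocycleExtension ψ hψ) : proj ψ hψ x = x.base := rfl

variable (ψ hψ) in
/-- The inclusion of the scalars into the central extension. -/
def ofScalar : ℂˣ →* CocycleExtension ψ hψ where
  toFun c := ⟨1, c * (ψ 1 1)⁻¹⟩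
  map_one' := by ext1 <;> simp
  map_mul' c d := by
    ext1
    · simp
    · simp only [mul_scalar]
      rw [mul_mul_mul_comm, ← mul_assoc, inv_mul_cancel_right]

@[simp] theorem ofScalar_base (c : ℂˣ) : (ofScalar ψ hψ c).base = 1 := rfl

theorem commute_ofScalar (c : ℂˣ) (x : CocycleExtension ψ hψ) : Commute (ofScalar ψ hψ c) x := by
  refine CocycleExtension.ext (by simp) ?_
  simp only [mul_scalar, ofScalar_base, hψ.one_left, hψ.one_right]
  rw [mul_comm x.scalar]

theorem exists_ofScalar_eq {x : CocycleExtension ψ hψ} (hx : x.base = 1) :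
    ∃ c, ofScalar ψ hψ c = x :=
  ⟨x.scalar * ψ 1 1, CocycleExtension.ext hx.symm (by simp [ofScalar])⟩

theorem exists_pow_eq_ofScalar {x : CocycleExtension ψ hψ} {m : ℕ} (h : x.base ^ m = 1) :
    ∃ c, x ^ m = ofScalar ψ hψ c := by
  obtain ⟨c, hc⟩ := exists_ofScalar_eq (x := x ^ m) ((map_pow (proj ψ hψ) x m).trans h)
  exact ⟨c, hc.symm⟩

theorem ofScalar_injective : Function.Injective (ofScalar ψ hψ) := fun _ _ h =>
  mul_right_cancel (congrArg scalar h)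

/-- A homomorphic section of the central extension trivialises the cocycle. -/
theorem isCoboundary_of_section (σ : G →* CocycleExtension ψ hψ)
    (hσ : ∀ g, (σ g).base = g) : IsCoboundary ψ := by
  refine ⟨fun g => (σ g).scalar⁻¹, fun g h => ?_⟩
  have := congrArg scalar (σ.map_mul g h)
  rw [mul_scalar, hσ, hσ] at this
  simp only [inv_inv, this]
  rw [← mul_assoc, ← mul_inv, inv_mul_cancel, one_mul]

variable (hψ) in
/-- The lifts of `t` commute with the lifts of every element commuting with `t`. -/
def LiftsCommute (t : G) : Prop :=
  ∀ x y : CocycleExtension ψ hψ, x.base = t → Commute x.base y.base → Commute x y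

theorem liftsCommute_of_isPsiRegular {t : G} (ht : IsPsiRegular ψ t) : LiftsCommute hψ t := by
  rintro x y rfl hxy
  have := ht y.base (Subgroup.mem_centralizer_singleton_iff.mpr hxy.symm)
  refine CocycleExtension.ext hxy ?_
  simp only [mul_scalar, this, mul_comm x.scalar]

theorem LiftsCommute.of_isConj {t u : G} (ht : LiftsCommute hψ t) (htu : IsConj t u) :
    LiftsCommute hψ u := by
  obtain ⟨c, rfl⟩ := isConj_iff.mp htu
  intro x y hx hxy
  let z : CocycleExtension ψ hψ := ⟨c, 1⟩
  have h := ht (z⁻¹ * x * z) (z⁻¹ * y * z) (by simp [hx, z, mul_assoc]) (by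
    have := (hxy.map (MulAut.conj c⁻¹).toMonoidHom)
    simpa [z] using this)
  have := h.map (MulAut.conj z).toMonoidHom
  simpa [mul_assoc] using this

theorem exists_sq_eq_one {t : G} (ht : t * t = 1) :
    ∃ x : CocycleExtension ψ hψ, x.base = t ∧ x * x = 1 := by
  let y : CocycleExtension ψ hψ := ⟨t, 1⟩
  obtain ⟨c, hc⟩ := exists_ofScalar_eq (x := y * y) ht
  obtain ⟨d, hd⟩ := IsAlgClosed.exists_pow_nat_eq (c⁻¹ : ℂˣ).val two_pos
  have hd0 : d ≠ 0 := by rintro rfl; exact (c⁻¹).ne_zero (by rw [← hd]; simp)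
  refine ⟨ofScalar ψ hψ (Units.mk0 d hd0) * y, by simp [y], ?_⟩
  have hd' : Units.mk0 d hd0 * Units.mk0 d hd0 = c⁻¹ := by
    ext; rw [← hd]; simp [sq]
  rw [(commute_ofScalar _ y).symm.mul_mul_mul_comm, ← map_mul, hd', ← hc, ← map_mul,
    inv_mul_cancel, map_one]

theorem scalar_sq_eq_one {x y : CocycleExtension ψ hψ} (hx : x * x = 1) (hy : y * y = 1) {m : ℕ}
    {c : ℂˣ} (hc : (x * y) ^ m = ofScalar ψ hψ c) : c ^ 2 = 1 := by
  have hx' : x⁻¹ = x := inv_eq_of_mul_eq_one_left hx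
  have hy' : y⁻¹ = y := inv_eq_of_mul_eq_one_left hy
  have h : x * (x * y) * x⁻¹ = (x * y)⁻¹ := by
    rw [mul_inv_rev, hx', hy', ← mul_assoc x x y, hx, one_mul]
  have h2 : x * (x * y) ^ m * x⁻¹ = ((x * y) ^ m)⁻¹ := by
    rw [← conj_pow, h, inv_pow]
  rw [hc, ← (commute_ofScalar c x).eq, mul_inv_cancel_right, ← map_inv] at h2
  have := ofScalar_injective h2
  rw [sq]
  nth_rw 1 [this]
  exact inv_mul_cancel c

theorem mul_pow_symm {x y : CocycleExtension ψ hψ} (hx : x * x = 1) {m : ℕ}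
    {c : ℂˣ} (hc : (x * y) ^ m = ofScalar ψ hψ c) : (y * x) ^ m = ofScalar ψ hψ c := by
  have hx' : x⁻¹ = x := inv_eq_of_mul_eq_one_left hx
  have h : x * (x * y) * x⁻¹ = y * x := by
    rw [← mul_assoc, hx, one_mul, hx']
  rw [← h, conj_pow, hc, ← (commute_ofScalar c x).eq, mul_inv_cancel_right]

theorem LiftsCommute.mul_pow_eq_one {x y : CocycleExtension ψ hψ} (hx : x * x = 1) (hy : y * y = 1)
    {m : ℕ} (hm : Even m) (hxy : (x.base * y.base) ^ m = 1) (h : LiftsCommute hψ x.base) :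
    (x * y) ^ m = 1 := by
  obtain ⟨k, rfl⟩ := hm
  have hx' : x⁻¹ = x := inv_eq_of_mul_eq_one_left hx
  have hy' : y⁻¹ = y := inv_eq_of_mul_eq_one_left hy
  have hconj : x * (x * y) ^ k * x⁻¹ = ((x * y) ^ k)⁻¹ := by
    rw [← conj_pow, ← inv_pow]
    congr 1
    rw [mul_inv_rev, hx', hy', ← mul_assoc x x y, hx, one_mul]
  have hinv : ((x.base * y.base) ^ k)⁻¹ = (x.base * y.base) ^ k :=
    inv_eq_of_mul_eq_one_left (by rw [← pow_add, hxy])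
  have hcomm := h x ((x * y) ^ k) rfl (by
    have := congrArg (proj ψ hψ) hconj
    simp only [map_mul, map_pow, map_inv, proj_apply, hinv] at this
    have hb : ((x * y) ^ k).base = (x.base * y.base) ^ k := map_pow (proj ψ hψ) _ _
    rw [hb]
    exact mul_inv_eq_iff_eq_mul.mp this)
  rw [hcomm.eq, mul_inv_cancel_right] at hconj
  rw [pow_add]
  nth_rw 2 [hconj]
  exact mul_inv_cancel _

end CocycleExtension

namespace CoxeterSystem

variable {B W : Type*} [Group W] {M : CoxeterMatrix B} (cs : CoxeterSystem M W)

theorem isConj_simple_of_odd {i j : B} (h : Odd (M i j)) :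
    IsConj (cs.simple i) (cs.simple j) := by
  obtain ⟨k, hk⟩ := h
  have hp : (cs.simple i * cs.simple j) ^ (2 * k + 1) = 1 := by
    rw [← hk]; exact cs.simple_mul_simple_pow i j
  set s := cs.simple i with hs
  set t := cs.simple j with ht
  have hs2 : s⁻¹ = s := cs.inv_simple i
  have ht2 : t⁻¹ = t := cs.inv_simple j
  have hconj : s * (s * t) ^ k * s⁻¹ = ((s * t) ^ k)⁻¹ := by
    rw [← conj_pow, ← inv_pow]
    congr 1
    rw [mul_inv_rev, hs2, ht2, ← mul_assoc s s t, cs.simple_mul_simple_self, one_mul]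
  refine isConj_iff.mpr ⟨(s * t) ^ k, ?_⟩
  have hu : (s * t) ^ k * (s * t) ^ k = (s * t)⁻¹ :=
    eq_inv_of_mul_eq_one_left (by rw [← pow_add, ← pow_succ, ← two_mul, hp])
  have hs1 : s * s = 1 := cs.simple_mul_simple_self i
  calc (s * t) ^ k * s * ((s * t) ^ k)⁻¹
      = (s * t) ^ k * (s * s) * (s * t) ^ k * s⁻¹ := by rw [← hconj]; simp only [mul_assoc]
    _ = (s * t)⁻¹ * s⁻¹ := by rw [hs1, mul_one, hu]
    _ = t := by rw [mul_inv_rev, hs2, mul_assoc, hs1, mul_one, ht2]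

theorem isConj_of_oddReachable {i j : B} (h : M.OddReachable i j) :
    IsConj (cs.simple i) (cs.simple j) := by
  induction h with
  | refl => exact IsConj.refl _
  | tail _ h ih => exact ih.trans (cs.isConj_simple_of_odd h)

open CocycleExtension

theorem isCoboundary_of_lifts {ψ : W → W → ℂˣ} {hψ : IsTwoCocycle ψ}
    (x : B → CocycleExtension ψ hψ) (hx : ∀ i, (x i).base = cs.simple i)
    (hrel : ∀ i j, (x i * x j) ^ M i j = 1) : IsCoboundary ψ := by
  let σ := cs.lift ⟨x, hrel⟩
  have hσ : (proj ψ hψ).comp σ = MonoidHom.id W := by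
    refine cs.ext_simple fun i => ?_
    rw [MonoidHom.comp_apply, cs.lift_apply_simple hrel, proj_apply, hx, MonoidHom.id_apply]
  exact isCoboundary_of_section σ fun g => DFunLike.congr_fun hσ g

theorem exists_involutive_lifts {ψ : W → W → ℂˣ} (hψ : IsTwoCocycle ψ) :
    ∃ (x : B → CocycleExtension ψ hψ) (c : B → B → ℂˣ), (∀ i, (x i).base = cs.simple i) ∧
      (∀ i, x i * x i = 1) ∧ (∀ i j, (x i * x j) ^ M i j = ofScalar ψ hψ (c i j)) ∧
      (∀ i j, c i j ^ 2 = 1) ∧ ∀ i j, c i j = c j i := by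
  choose x hx hx2 using fun i => exists_sq_eq_one (hψ := hψ) (cs.simple_mul_simple_self i)
  choose c hc using fun i j => exists_pow_eq_ofScalar (x := x i * x j) (m := M i j)
    (by rw [mul_base, hx, hx]; exact cs.simple_mul_simple_pow i j)
  refine ⟨x, c, hx, hx2, hc, fun i j => scalar_sq_eq_one (hx2 i) (hx2 j) (hc i j), fun i j => ?_⟩
  refine ofScalar_injective (hψ := hψ) ?_
  rw [← mul_pow_symm (hx2 i) (hc i j), M.symmetric, hc]

theorem isCoboundary_of_liftsCommute {ψ : W → W → ℂˣ} (hψ : IsTwoCocycle ψ)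
    [Fintype B] [DecidableEq B] (hpos : ∀ v : B → ℝ, v ≠ 0 → 0 < M.titsForm v v)
    (h : ∀ i j, i ≠ j → Even (M i j) →
      LiftsCommute hψ (cs.simple i) ∨ LiftsCommute hψ (cs.simple j)) : IsCoboundary ψ := by
  obtain ⟨x, c, hx, hx2, hc, hc2, hcsymm⟩ := cs.exists_involutive_lifts hψ
  obtain ⟨ε, hε2, hε⟩ := CoxeterMatrix.exists_signs hpos c hc2 hcsymm
  refine cs.isCoboundary_of_lifts (fun i => ofScalar ψ hψ (ε i) * x i) (by simp [hx])
    fun i j => ?_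
  have hmul : (ofScalar ψ hψ (ε i) * x i) * (ofScalar ψ hψ (ε j) * x j) =
      ofScalar ψ hψ (ε i * ε j) * (x i * x j) := by
    rw [(commute_ofScalar (ε j) (x i)).symm.mul_mul_mul_comm, map_mul]
  have hsq : (ε i * ε j) ^ 2 = 1 := by rw [mul_pow, hε2, hε2, one_mul]
  rw [hmul, (commute_ofScalar _ _).mul_pow, ← map_pow]
  by_cases hij : i = j
  · subst hij
    rw [M.diagonal, pow_one, pow_one, hx2, ← sq, hε2, map_one, one_mul]
  rcases (M i j).even_or_odd with he | ho
  · have hrel : (cs.simple i * cs.simple j) ^ M i j = 1 := cs.simple_mul_simple_pow i j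
    have h1 : (x i * x j) ^ M i j = 1 := by
      rcases h i j hij he with hi | hj
      · exact LiftsCommute.mul_pow_eq_one (hx2 i) (hx2 j) he (by rwa [hx, hx]) (by rwa [hx])
      · have := LiftsCommute.mul_pow_eq_one (hx2 j) (hx2 i) he
          (by rw [hx, hx, M.symmetric]; exact cs.simple_mul_simple_pow j i) (by rwa [hx])
        rw [← map_one (ofScalar ψ hψ)] at this ⊢
        exact mul_pow_symm (hx2 j) this
    obtain ⟨k, hk⟩ := he
    rw [h1, hk, ← two_mul, pow_mul, hsq, one_pow, map_one, one_mul]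
  · have h2 : M i j ≠ 2 := by intro h2; rw [h2] at ho; exact absurd ho (by decide)
    obtain ⟨k, hk⟩ := ho
    rw [hc, ← map_mul, hk, pow_succ, pow_mul, hsq, one_pow, one_mul, hε i j hij h2, ← sq, hc2,
      map_one]

end CoxeterSystem

/-- Let `(W, S)` be a finite Coxeter system with connected Coxeter graph which
is not of type `Bₙ`.  If some reflection of `W` is `ψ`-regular for a
2-cocycle `ψ`, then `ψ` is a coboundary. -/
theorem reflection_regular_implies_coboundary
    {B : Type} [Finite B] {W : Type} [Group W] [Finite W]
    (M : CoxeterMatrix B) (cs : CoxeterSystem M W)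
    (hconn : ¬ ∃ B₁ B₂ : Set B, B₁.Nonempty ∧ B₂.Nonempty ∧
      B₁ ∪ B₂ = Set.univ ∧ B₁ ∩ B₂ = ∅ ∧
      ∀ i ∈ B₁, ∀ j ∈ B₂, Commute (cs.simple i) (cs.simple j))
    (hnotB : ¬ ∃ (n : ℕ) (e : B ≃ Fin n), M.reindex e = CoxeterMatrix.Bₙ n)
    (ψ : W → W → ℂˣ) (hψ : IsTwoCocycle ψ)
    (h : ∃ t : W, cs.IsReflection t ∧ IsPsiRegular ψ t) :
    IsCoboundary ψ := by
  obtain ⟨t, ⟨w, i₀, rfl⟩, ht⟩ := h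
  have := Fintype.ofFinite B
  classical
  have hpos := fun v hv => cs.titsForm_pos hconn (v := v) hv
  refine cs.isCoboundary_of_liftsCommute hψ hpos fun i j hij he => ?_
  have h₀ : CocycleExtension.LiftsCommute hψ (cs.simple i₀) :=
    (CocycleExtension.liftsCommute_of_isPsiRegular ht).of_isConj
      (isConj_iff.mpr ⟨w, rfl⟩).symm
  by_contra! H
  refine hnotB (CoxeterMatrix.exists_reindex_eq_B hpos (i₀ := i₀)
    (fun s x y hx hy => cs.exists_edge_of_connected hconn s hx hy)
    (fun hi => H.1 (h₀.of_isConj (cs.isConj_of_oddReachable hi)))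
    (fun hj => H.2 (h₀.of_isConj (cs.isConj_of_oddReachable hj))) hij he)
end
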